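/- Let G be a countable discrete infinite amenable group acting continuously on a compact metric space (X,d), let {F_n} be a tempered Følner sequence in G satisfying lim_{n→∞} |F_n|/log n = ∞, and let μ be an ergodic G-invariant Borel probability measure on X. Let G_μ = {x ∈ X : (1/|F_n|) Σ_{g∈F_n} f(gx) → ∫_X f dμ for every continuous f : X → ℝ} be the set of generic points for μ with respect to {F_n}. Then h^B_top(G_μ,{F_n}) = h_μ(X,G). -/

import Mathlib

open MeasureTheory Filter Set
open scoped Pointwise ENNReal NNReal Topology

section Defs

variable {G : Type*} [Group G] [DecidableEq G] {X : Type*}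

/-- A Følner sequence: a sequence of nonempty finite subsets of `G` that is asymptotically
invariant: `|Fₙ △ gFₙ|/|Fₙ| → 0` for every `g ∈ G`. -/
def IsFolnerSeq (F : ℕ → Finset G) : Prop :=
  (∀ n, (F n).Nonempty) ∧
    ∀ g : G, Tendsto (fun n => ((symmDiff (F n) ((F n).image (g * ·))).card : ℝ) / (F n).card)
      atTop (𝓝 0)

/-- A sequence of finite subsets is tempered if `|⋃_{k<n} Fₖ⁻¹ Fₙ| ≤ C |Fₙ|` for a constant `C`. -/
def IsTemperedSeq (F : ℕ → Finset G) : Prop :=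
  ∃ C : ℝ, ∀ n : ℕ, (((Finset.range n).biUnion fun k => (F k)⁻¹ * F n).card : ℝ) ≤ C * (F n).card

/-- The growth condition `|Fₙ|/log n → ∞`. -/
def GrowthCond (F : ℕ → Finset G) : Prop :=
  Tendsto (fun n => ((F n).card : ℝ) / Real.log n) atTop atTop

variable [MetricSpace X] [MulAction G X]

/-- The Bowen ball `B_F(x,ε) = {y : d(gx, gy) < ε for all g ∈ F}`. -/
def bowenBall (F : Finset G) (x : X) (ε : ℝ) : Set X :=
  {y | ∀ g ∈ F, dist (g • x) (g • y) < ε}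

/-- `M(Z,N,ε,s,{Fₙ})`: infimum of `Σᵢ exp(-s |F_{nᵢ}|)` over countable families of Bowen balls
`B_{F_{nᵢ}}(xᵢ,ε)` with `nᵢ ≥ N` covering `Z`. -/
noncomputable def bowenMpre (F : ℕ → Finset G) (Z : Set X) (N : ℕ) (ε s : ℝ) : ℝ≥0∞ :=
  ⨅ (C : Set (X × ℕ)) (_ : C.Countable ∧ (∀ p ∈ C, N ≤ p.2) ∧
      Z ⊆ ⋃ p ∈ C, bowenBall (F p.2) p.1 ε),
    ∑' p : C, ENNReal.ofReal (Real.exp (-s * ((F (p : X × ℕ).2).card : ℝ)))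

/-- `M(Z,s,{Fₙ}) = lim_{ε→0} lim_{N→∞} M(Z,N,ε,s,{Fₙ})`; since the quantity is monotone
(nondecreasing as `N` increases and as `ε` decreases), the limits are suprema. -/
noncomputable def bowenMeasure (F : ℕ → Finset G) (Z : Set X) (s : ℝ) : ℝ≥0∞ :=
  ⨆ (ε : ℝ) (_ : 0 < ε), ⨆ N : ℕ, bowenMpre F Z N ε s

/-- The Bowen topological entropy of `Z` along `{Fₙ}`: the critical value of `s` at which
`M(Z,s,{Fₙ})` jumps from `+∞` to `0`. -/
noncomputable def bowenEntropy (F : ℕ → Finset G) (Z : Set X) : ℝ≥0∞ :=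
  ⨆ (s : ℝ) (_ : bowenMeasure F Z s = ⊤), ENNReal.ofReal s

/-- The minimal cardinality of a subcover of `⋁_{g ∈ F} g⁻¹ U` for a cover `U`. -/
noncomputable def coverNumber (U : Finset (Set X)) (F : Finset G) : ℕ :=
  sInf {k : ℕ | ∃ f : Fin k → G → Set X, (∀ i, ∀ g ∈ F, f i g ∈ U) ∧
    (univ : Set X) ⊆ ⋃ i, ⋂ g ∈ F, (fun x => g • x) ⁻¹' f i g}

/-- The topological entropy of the `G`-action on `X` (computed along `{Fₙ}`; it is independent
of the Følner sequence). -/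
noncomputable def topEntropy (X : Type*) [MetricSpace X] {G : Type*} [Group G] [MulAction G X]
    (F : ℕ → Finset G) : ℝ≥0∞ :=
  ⨆ (U : Finset (Set X)) (_ : (∀ V ∈ U, IsOpen V) ∧ ⋃₀ (U : Set (Set X)) = univ),
    limsup (fun n => ENNReal.ofReal (Real.log (coverNumber U (F n)) / (F n).card)) atTop

end Defs

section MeasDefs

variable {G : Type*} [Group G] [DecidableEq G] {X : Type*} [MeasurableSpace X] [MulAction G X]

/-- The Shannon entropy `H_μ(⋁_{g∈F} g⁻¹ P)` of the join over `F` of the finite measurable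
partition `P` given by the fibers of `α`. -/
noncomputable def partitionEntropy (μ : Measure X) {ι : Type*} [Fintype ι] (α : X → ι)
    (F : Finset G) : ℝ :=
  ∑ f : ↥F → ι, Real.negMulLog ((μ {x | ∀ g : ↥F, α ((g : G) • x) = f g}).toReal)

/-- The entropy `h_μ(G,P) = lim_n H_μ(P^{Fₙ})/|Fₙ|` of the partition given by the fibers
of `α` (the limit existing, it is the `limsup`). -/
noncomputable def partitionDynEntropy (F : ℕ → Finset G) (μ : Measure X) {ι : Type*} [Fintype ι]
    (α : X → ι) : ℝ :=
  limsup (fun n => partitionEntropy μ α (F n) / (F n).card) atTop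

/-- The measure-theoretic entropy `h_μ(X,G)`: the supremum over finite measurable partitions
(encoded as measurable maps `X → Fin k`) of `lim_n H_μ(P^{Fₙ})/|Fₙ|`. -/
noncomputable def measEntropy (F : ℕ → Finset G) (μ : Measure X) : ℝ≥0∞ :=
  ⨆ (k : ℕ) (α : X → Fin k) (_ : Measurable α),
    limsup (fun n => ENNReal.ofReal (partitionEntropy μ α (F n) / (F n).card)) atTop

/-- `μ` is `G`-invariant. -/
def InvariantMeasure (G : Type*) [Group G] [MulAction G X] (μ : Measure X) : Prop :=
  ∀ g : G, Measure.map (fun x => g • x) μ = μ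

/-- `μ` is ergodic: every Borel set `A` with `μ(A △ g⁻¹A) = 0` for all `g` is trivial. -/
def ErgodicMeasure (G : Type*) [Group G] [MulAction G X] (μ : Measure X) : Prop :=
  ∀ A : Set X, MeasurableSet A →
    (∀ g : G, μ (symmDiff A ((fun x => g • x) ⁻¹' A)) = 0) → μ A = 0 ∨ μ A = 1

end MeasDefs

section LocalDefs

variable {G : Type*} [Group G] [DecidableEq G] {X : Type*} [MetricSpace X] [MulAction G X]
  [MeasurableSpace X]

/-- The set of generic points of `μ` with respect to `{Fₙ}`. -/
def genericPointSet (F : ℕ → Finset G) (μ : Measure X) : Set X :=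
  {x | ∀ f : C(X, ℝ),
    Tendsto (fun n => (∑ g ∈ F n, f (g • x)) / (F n).card) atTop (𝓝 (∫ y, f y ∂μ))}

/-- The lower local entropy of `μ` at `x` along `{Fₙ}`:
`lim_{δ→0} liminf_n -(1/|Fₙ|) log μ(B_{Fₙ}(x,δ))` (the limit in `δ` being a supremum
by monotonicity). -/
noncomputable def localLowerEntropy (F : ℕ → Finset G) (μ : Measure X) (x : X) : ℝ≥0∞ :=
  ⨆ (δ : ℝ) (_ : 0 < δ),
    liminf (fun n =>
      ENNReal.ofReal (-(Real.log ((μ (bowenBall (F n) x δ)).toReal)) / (F n).card)) atTop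

end LocalDefs


open MeasureTheory Filter Set
open scoped Pointwise ENNReal NNReal Topology

section Comb
variable {G : Type*} [Group G] [DecidableEq G]

/-- Right translate of a finite set. -/
def tile (K : Finset G) (a : G) : Finset G := K.image (· * a)

lemma mem_tile {K : Finset G} {a h : G} : h ∈ tile K a ↔ h * a⁻¹ ∈ K := by
  unfold tile
  rw [Finset.mem_image]
  constructor
  · rintro ⟨b, hb, rfl⟩; simpa using hb
  · intro hh; exact ⟨_, hh, by simp⟩

lemma card_tile (K : Finset G) (a : G) : (tile K a).card = K.card :=
  Finset.card_image_of_injective _ (mul_left_injective a)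

lemma mem_tile_iff_inv {K : Finset G} {a h : G} : h ∈ tile K a ↔ a ∈ tile K⁻¹ h := by
  rw [mem_tile, mem_tile, Finset.mem_inv']
  simp

/-- Greedy selection of nearly disjoint translates of a single shape. -/
lemma greedy_single (K A : Finset G) (hK : K.Nonempty) (κ : ℝ) (hκ1 : κ < 1) :
    ∃ S ⊆ A, (1 - κ) * (∑ _a ∈ S, (K.card : ℝ)) ≤ ((S.biUnion (tile K)).card : ℝ) ∧
      κ * (A.card : ℝ) ≤ ((S.biUnion (tile K)).card : ℝ) := by
  classical
  have hKc : (0 : ℝ) < K.card := by exact_mod_cast hK.card_pos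
  let P : Finset (Finset G) := A.powerset.filter
    (fun S => (1 - κ) * (∑ _a ∈ S, (K.card : ℝ)) ≤ ((S.biUnion (tile K)).card : ℝ))
  have hP : P.Nonempty := ⟨∅, by simp [P]⟩
  obtain ⟨S, hSP, hmax⟩ := P.exists_max_image Finset.card hP
  have hS : S ⊆ A ∧ (1 - κ) * (∑ _a ∈ S, (K.card : ℝ)) ≤ ((S.biUnion (tile K)).card : ℝ) := by
    simpa [P] using hSP
  refine ⟨S, hS.1, hS.2, ?_⟩
  set U := S.biUnion (tile K) with hU
  have key : ∀ a ∈ A, κ * (K.card : ℝ) ≤ ((tile K a ∩ U).card : ℝ) := by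
    intro a ha
    by_cases haS : a ∈ S
    · have : tile K a ∩ U = tile K a :=
        Finset.inter_eq_left.2 (Finset.subset_biUnion_of_mem (tile K) haS)
      rw [this, card_tile]; nlinarith
    · by_contra hcon
      push Not at hcon
      have hins : insert a S ∈ P := by
        simp only [P, Finset.mem_filter, Finset.mem_powerset]
        refine ⟨Finset.insert_subset ha hS.1, ?_⟩
        rw [Finset.sum_insert haS, Finset.biUnion_insert, ← hU]
        have h1 : ((tile K a ∪ U).card : ℝ) = (tile K a).card + U.card - (tile K a ∩ U).card := by
          have := Finset.card_union_add_card_inter (tile K a) U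
          have : ((tile K a ∪ U).card : ℝ) + (tile K a ∩ U).card = (tile K a).card + U.card := by
            exact_mod_cast this
          linarith
        rw [h1, card_tile]
        linarith [hS.2]
      have := hmax _ hins
      rw [Finset.card_insert_of_notMem haS] at this
      omega
  have h2 : ∑ a ∈ A, ((tile K a ∩ U).card : ℝ) ≤ U.card * K.card := by
    have : ∑ a ∈ A, (tile K a ∩ U).card ≤ U.card * K.card := by
      calc ∑ a ∈ A, (tile K a ∩ U).card
          = ∑ a ∈ A, ∑ u ∈ U, if u ∈ tile K a then 1 else 0 := by
            refine Finset.sum_congr rfl fun a _ => ?_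
            rw [Finset.inter_comm, ← Finset.filter_mem_eq_inter, Finset.card_filter]
        _ = ∑ u ∈ U, ∑ a ∈ A, if u ∈ tile K a then 1 else 0 := Finset.sum_comm
        _ ≤ ∑ u ∈ U, K.card := by
            refine Finset.sum_le_sum fun u _ => ?_
            rw [← Finset.card_filter]
            have : A.filter (fun a => u ∈ tile K a) ⊆ tile K⁻¹ u := by
              intro a ha
              rw [Finset.mem_filter] at ha
              exact mem_tile_iff_inv.1 ha.2
            refine (Finset.card_le_card this).trans ?_
            rw [card_tile, Finset.card_inv]
        _ = _ := by simp
    exact_mod_cast this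
  have h3 : (A.card : ℝ) * (κ * K.card) ≤ U.card * K.card := by
    refine le_trans ?_ h2
    rw [← nsmul_eq_mul]
    exact Finset.card_nsmul_le_sum _ _ _ key
  have : κ * A.card * K.card ≤ U.card * K.card := by linarith
  exact le_of_mul_le_mul_right this hKc

/-- Union of tiles with centers in `S` and labels `ν`. -/
def tiles (F : ℕ → Finset G) (ν : G → ℕ) (S : Finset G) : Finset G :=
  S.biUnion fun a => tile (F (ν a)) a

/-- Greedy selection for one tempered scale. -/
lemma greedy_scale (F : ℕ → Finset G) (hne : ∀ n, (F n).Nonempty) (C : ℝ) (hC : 0 ≤ C)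
    (hT : ∀ n : ℕ, (((Finset.range n).biUnion fun k => (F k)⁻¹ * F n).card : ℝ)
      ≤ C * (F n).card) (ν : G → ℕ) (κ : ℝ) (hκ0 : 0 < κ) (hκ1 : κ < 1) (N : ℕ) :
    ∀ A : Finset G, (∀ a ∈ A, ν a < N) →
    ∃ S ⊆ A, (1 - κ) * (∑ a ∈ S, ((F (ν a)).card : ℝ)) ≤ ((tiles F ν S).card : ℝ) ∧
      (A.card : ℝ) ≤ (1 / κ + C / (1 - κ)) * ((tiles F ν S).card : ℝ) := by
  classical
  have h1κ : 0 < 1 - κ := by linarith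
  induction N with
  | zero =>
    intro A hA
    have : A = ∅ := Finset.eq_empty_of_forall_notMem fun a ha => by simpa using hA a ha
    subst this
    exact ⟨∅, le_rfl, by simp [tiles], by simp [tiles]⟩
  | succ N ih =>
    intro A hA
    obtain ⟨S₁, hS₁A, hS₁a, hS₁b⟩ := greedy_single (F N) (A.filter (fun a => ν a = N)) (hne N) κ hκ1
    set U := S₁.biUnion (tile (F N)) with hU
    have hUt : tiles F ν S₁ = U := by
      refine Finset.biUnion_congr rfl fun a ha => ?_
      rw [(Finset.mem_filter.1 (hS₁A ha)).2]
    have hsum1 : ∑ a ∈ S₁, ((F (ν a)).card : ℝ) = ∑ _a ∈ S₁, ((F N).card : ℝ) := by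
      refine Finset.sum_congr rfl fun a ha => ?_
      rw [(Finset.mem_filter.1 (hS₁A ha)).2]
    set A' := A.filter (fun a => ν a < N ∧ Disjoint (tile (F (ν a)) a) U) with hA'
    obtain ⟨S₂, hS₂A, hS₂a, hS₂b⟩ := ih A' (fun a ha => (Finset.mem_filter.1 ha).2.1)
    have hdisjU : Disjoint U (tiles F ν S₂) := by
      rw [tiles, Finset.disjoint_biUnion_right]
      intro a ha
      exact (Finset.mem_filter.1 (hS₂A ha)).2.2.symm
    have hdisjS : Disjoint S₁ S₂ := by
      rw [Finset.disjoint_left]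
      intro a h1 h2
      have e1 := (Finset.mem_filter.1 (hS₁A h1)).2
      have e2 := (Finset.mem_filter.1 (hS₂A h2)).2.1
      omega
    have hunion : tiles F ν (S₁ ∪ S₂) = U ∪ tiles F ν S₂ := by
      rw [← hUt]; simp only [tiles, Finset.union_biUnion]
    have hcard : ((tiles F ν (S₁ ∪ S₂)).card : ℝ) = U.card + (tiles F ν S₂).card := by
      rw [hunion, Finset.card_union_of_disjoint hdisjU]; push_cast; rfl
    refine ⟨S₁ ∪ S₂, Finset.union_subset (hS₁A.trans (Finset.filter_subset _ _))
      (hS₂A.trans (Finset.filter_subset _ _)), ?_, ?_⟩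
    · rw [Finset.sum_union hdisjS, hcard, hsum1]
      linarith
    · rw [hcard]
      have hcov : A ⊆ A.filter (fun a => ν a = N) ∪ A' ∪
          S₁.biUnion (fun b => tile ((Finset.range N).biUnion fun k => (F k)⁻¹ * F N) b) := by
        intro a ha
        by_cases h1 : ν a = N
        · simp [ha, h1]
        have h2 : ν a < N := by have := hA a ha; omega
        by_cases h3 : Disjoint (tile (F (ν a)) a) U
        · simp [hA', ha, h2, h3]
        · rw [Finset.not_disjoint_iff] at h3
          obtain ⟨h, hh1, hh2⟩ := h3
          rw [hU, Finset.mem_biUnion] at hh2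
          obtain ⟨b, hb, hhb⟩ := hh2
          rw [Finset.mem_union]; right
          rw [Finset.mem_biUnion]
          refine ⟨b, hb, ?_⟩
          rw [mem_tile, Finset.mem_biUnion]
          refine ⟨ν a, by simpa using h2, ?_⟩
          rw [mem_tile] at hh1 hhb
          rw [Finset.mem_mul]
          exact ⟨(h * a⁻¹)⁻¹, by simpa using hh1, h * b⁻¹, hhb, by group⟩
      have hc1 : (A.card : ℝ) ≤ (A.filter (fun a => ν a = N)).card + A'.card
          + ∑ b ∈ S₁, C * ((F N).card : ℝ) := by
        have h1 := (Finset.card_le_card hcov).trans ((Finset.card_union_le _ _).trans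
          (Nat.add_le_add (Finset.card_union_le _ _) Finset.card_biUnion_le))
        have h2 : (A.card : ℝ) ≤ (A.filter (fun a => ν a = N)).card + A'.card +
          ∑ b ∈ S₁, ((tile ((Finset.range N).biUnion fun k => (F k)⁻¹ * F N) b).card : ℝ) := by
          exact_mod_cast h1
        refine h2.trans ?_
        gcongr with b hb
        rw [card_tile]; exact hT N
      rw [← Finset.mul_sum] at hc1
      have e1 : ((A.filter (fun a => ν a = N)).card : ℝ) ≤ 1 / κ * U.card := by
        rw [one_div, inv_mul_eq_div, le_div_iff₀ hκ0]; linarith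
      have e2 : C * (∑ b ∈ S₁, ((F N).card : ℝ)) ≤ C / (1 - κ) * U.card := by
        rw [div_mul_eq_mul_div, le_div_iff₀ h1κ]
        nlinarith [mul_le_mul_of_nonneg_left hS₁a hC]
      nlinarith
end Comb

open MeasureTheory Filter Set
open scoped Pointwise ENNReal NNReal Topology

section Comb2
variable {G : Type*} [Group G] [DecidableEq G] {L : Type*}

/-- Union of a finite family of labelled tiles. -/
def ltiles (F : ℕ → Finset G) (n : L → ℕ) (T : Finset (G × L)) : Finset G :=
  T.biUnion fun q => tile (F (n q.2)) q.1

/-- Multi-scale covering. -/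
lemma greedy_multi (F : ℕ → Finset G) (hne : ∀ n, (F n).Nonempty) (C : ℝ) (hC : 0 ≤ C)
    (hT : ∀ n : ℕ, (((Finset.range n).biUnion fun k => (F k)⁻¹ * F n).card : ℝ)
      ≤ C * (F n).card) (n : L → ℕ) (κ : ℝ) (hκ0 : 0 < κ) (hκ1 : κ < 1)
    (η κ' δ : ℝ) (hη : 0 < η) (hκ' : κ' ≤ (1 - κ) * η / 4) (hκ'0 : 0 ≤ κ') (hδ : δ ≤ η / 4)
    (M : ℕ) (D : ℕ → Finset L)
    (hD : ∀ i j, j < i → ∀ p ∈ D i,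
      (((((D j).biUnion fun q => F (n q))⁻¹ * F (n p)) \ F (n p)).card : ℝ) ≤ κ' * (F (n p)).card)
    (E : Finset G) (A : ℕ → Finset G) (l : ℕ → G → L)
    (hAE : ∀ i < M, A i ⊆ E) (hlD : ∀ i < M, ∀ a ∈ A i, l i a ∈ D i)
    (hlE : ∀ i < M, ∀ a ∈ A i, tile (F (n (l i a))) a ⊆ E)
    (hA : ∀ i < M, ((E \ A i).card : ℝ) ≤ δ * E.card) :
    ∀ t ≤ M, ∃ T : Finset (G × L),
      (∀ q ∈ T, ∃ i < M, M - t ≤ i ∧ q.1 ∈ A i ∧ q.2 = l i q.1) ∧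
      (1 - κ) * (∑ q ∈ T, ((F (n q.2)).card : ℝ)) ≤ ((ltiles F n T).card : ℝ) ∧
      ltiles F n T ⊆ E ∧
      ((1 - η) * E.card ≤ ((ltiles F n T).card : ℝ) ∨
        t * (η / (2 * (1 / κ + C / (1 - κ)))) * E.card ≤ ((ltiles F n T).card : ℝ)) := by
  classical
  have h1κ : 0 < 1 - κ := by linarith
  set c₀ := 1 / κ + C / (1 - κ) with hc₀
  have hc₀pos : 0 < c₀ := by positivity
  intro t
  induction t with
  | zero =>
    intro _
    exact ⟨∅, by simp, by simp [ltiles], by simp [ltiles], Or.inr (by simp)⟩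
  | succ t ih =>
    intro ht
    obtain ⟨T, hT1, hT2, hT3, hT4⟩ := ih (by omega)
    by_cases hbig : (1 - η) * E.card ≤ ((ltiles F n T).card : ℝ)
    · refine ⟨T, fun q hq => ?_, hT2, hT3, Or.inl hbig⟩
      obtain ⟨i, hi, hi', h⟩ := hT1 q hq
      exact ⟨i, hi, by omega, h⟩
    have hT4' := hT4.resolve_left hbig
    push Not at hbig
    set U := ltiles F n T with hU
    set i := M - (t + 1) with hi
    have hiM : i < M := by omega
    set A' := (A i).filter (fun a => a ∉ U ∧ Disjoint (tile (F (n (l i a))) a) U) with hA'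
    set K := (D i).biUnion fun q => F (n q) with hK
    obtain ⟨S, hSA, hS1, hS2⟩ := greedy_scale F hne C hC hT (fun a => n (l i a)) κ hκ0 hκ1
      (A'.sup (fun a => n (l i a)) + 1) A'
      (fun a ha => Nat.lt_succ_of_le (Finset.le_sup (f := fun a => n (l i a)) ha))
    set V := tiles F (fun a => n (l i a)) S with hV
    -- the counting
    have hcov : E ⊆ U ∪ (E \ A i) ∪ A' ∪
        T.biUnion (fun q => tile ((K⁻¹ * F (n q.2)) \ F (n q.2)) q.1) := by
      intro a ha
      by_cases h1 : a ∈ U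
      · simp [h1]
      by_cases h2 : a ∈ A i
      swap
      · simp [h2, ha]
      by_cases h3 : Disjoint (tile (F (n (l i a))) a) U
      · simp [hA', h1, h2, h3]
      · rw [Finset.mem_union]; right
        rw [Finset.not_disjoint_iff] at h3
        obtain ⟨h, hh1, hh2⟩ := h3
        rw [hU, ltiles, Finset.mem_biUnion] at hh2
        obtain ⟨q, hq, hhq⟩ := hh2
        rw [Finset.mem_biUnion]
        refine ⟨q, hq, ?_⟩
        rw [mem_tile, Finset.mem_sdiff]
        rw [mem_tile] at hh1 hhq
        constructor
        · rw [Finset.mem_mul]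
          refine ⟨(h * a⁻¹)⁻¹, ?_, h * q.1⁻¹, hhq, by group⟩
          refine Finset.inv_mem_inv ?_
          rw [hK, Finset.mem_biUnion]
          exact ⟨_, hlD i hiM a h2, hh1⟩
        · intro h4
          apply h1
          rw [hU, ltiles, Finset.mem_biUnion]
          exact ⟨q, hq, mem_tile.2 h4⟩
    have hUE : (U.card : ℝ) ≤ E.card := by exact_mod_cast Finset.card_le_card hT3
    have hc1 : (E.card : ℝ) ≤ U.card + (E \ A i).card + A'.card
        + κ' * ∑ q ∈ T, ((F (n q.2)).card : ℝ) := by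
      have h1 := (Finset.card_le_card hcov).trans ((Finset.card_union_le _ _).trans
        (Nat.add_le_add ((Finset.card_union_le _ _).trans
          (Nat.add_le_add_right (Finset.card_union_le _ _) _)) Finset.card_biUnion_le))
      have h2 : (E.card : ℝ) ≤ U.card + (E \ A i).card + A'.card +
        ∑ q ∈ T, ((tile ((K⁻¹ * F (n q.2)) \ F (n q.2)) q.1).card : ℝ) := by
        exact_mod_cast h1
      refine h2.trans ?_
      rw [Finset.mul_sum]
      gcongr with q hq
      rw [card_tile]
      obtain ⟨j, hj, hj', hj1, hj2⟩ := hT1 q hq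
      refine hD j i (by omega) _ ?_
      rw [hj2]; exact hlD j hj _ hj1
    have hc2 : κ' * ∑ q ∈ T, ((F (n q.2)).card : ℝ) ≤ η / 4 * E.card := by
      have hs0 : 0 ≤ ∑ q ∈ T, ((F (n q.2)).card : ℝ) := Finset.sum_nonneg fun _ _ => by positivity
      calc κ' * ∑ q ∈ T, ((F (n q.2)).card : ℝ)
          ≤ ((1 - κ) * η / 4) * ∑ q ∈ T, ((F (n q.2)).card : ℝ) := by gcongr
        _ = η / 4 * ((1 - κ) * ∑ q ∈ T, ((F (n q.2)).card : ℝ)) := by ring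
        _ ≤ η / 4 * E.card := by gcongr; exact hT2.trans hUE
    have hc3 : ((E \ A i).card : ℝ) ≤ η / 4 * E.card := (hA i hiM).trans (by gcongr)
    have hA'c : η / 2 * E.card ≤ A'.card := by linarith
    have hVc : η / (2 * c₀) * E.card ≤ V.card := by
      have : η / 2 * E.card ≤ c₀ * V.card := hA'c.trans hS2
      have e : η / (2 * c₀) * E.card = (η / 2 * E.card) / c₀ := by field_simp
      rw [e, div_le_iff₀ hc₀pos]; linarith
    have hdisjUV : Disjoint U V := by
      rw [hV, tiles, Finset.disjoint_biUnion_right]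
      intro a ha
      exact (Finset.mem_filter.1 (hSA ha)).2.2.symm
    set T' := S.image (fun a => (a, l i a)) with hT'
    have hdisjT : Disjoint T T' := by
      rw [Finset.disjoint_left]
      intro q hq hq'
      obtain ⟨a, ha, rfl⟩ := Finset.mem_image.1 hq'
      have h1 : tile (F (n (l i a))) a ⊆ U :=
        Finset.subset_biUnion_of_mem (fun q : G × L => tile (F (n q.2)) q.1) hq
      have h2 := (Finset.mem_filter.1 (hSA ha)).2.2
      have h3 : (tile (F (n (l i a))) a).Nonempty := by
        rw [← Finset.card_pos, card_tile, Finset.card_pos]; exact hne _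
      obtain ⟨y, hy⟩ := h3
      exact Finset.disjoint_left.1 h2 hy (h1 hy)
    have hTV : ltiles F n T' = V := by
      rw [ltiles, hT', Finset.image_biUnion, hV, tiles]
    have hun : ltiles F n (T ∪ T') = U ∪ V := by
      rw [ltiles, Finset.union_biUnion]
      change ltiles F n T ∪ ltiles F n T' = _
      rw [hTV]
    have hsum' : ∑ q ∈ T', ((F (n q.2)).card : ℝ) = ∑ a ∈ S, ((F (n (l i a))).card : ℝ) := by
      rw [hT', Finset.sum_image]
      intro a _ b _ hab
      exact (Prod.mk.inj hab).1
    have hcard : ((ltiles F n (T ∪ T')).card : ℝ) = U.card + V.card := by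
      rw [hun, Finset.card_union_of_disjoint hdisjUV]; push_cast; rfl
    refine ⟨T ∪ T', ?_, ?_, ?_, Or.inr ?_⟩
    · intro q hq
      rcases Finset.mem_union.1 hq with hq | hq
      · obtain ⟨j, hj, hj', h⟩ := hT1 q hq
        exact ⟨j, hj, by omega, h⟩
      · obtain ⟨a, ha, rfl⟩ := Finset.mem_image.1 hq
        exact ⟨i, hiM, le_rfl, (Finset.mem_filter.1 (hSA ha)).1, rfl⟩
    · rw [Finset.sum_union hdisjT, hcard, hsum']
      linarith
    · rw [hun]
      refine Finset.union_subset hT3 ?_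
      rw [hV, tiles, Finset.biUnion_subset]
      intro a ha
      exact hlE i hiM a (Finset.mem_filter.1 (hSA ha)).1
    · rw [hcard]
      push_cast
      linarith

/-- Final form of the multi-scale covering lemma. -/
lemma greedy_multi' (F : ℕ → Finset G) (hne : ∀ n, (F n).Nonempty) (C : ℝ) (hC : 0 ≤ C)
    (hT : ∀ n : ℕ, (((Finset.range n).biUnion fun k => (F k)⁻¹ * F n).card : ℝ)
      ≤ C * (F n).card) (κ : ℝ) (hκ0 : 0 < κ) (hκ1 : κ < 1) (η : ℝ) (hη : 0 < η) :
    ∃ M : ℕ, ∃ κ' > 0, ∃ δ > 0, ∀ (n : L → ℕ) (D : ℕ → Finset L)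
    (_ : ∀ i j, j < i → ∀ p ∈ D i,
      (((((D j).biUnion fun q => F (n q))⁻¹ * F (n p)) \ F (n p)).card : ℝ) ≤ κ' * (F (n p)).card)
    (E : Finset G) (A : ℕ → Finset G) (l : ℕ → G → L)
    (_ : E.Nonempty)
    (_ : ∀ i < M, A i ⊆ E) (_ : ∀ i < M, ∀ a ∈ A i, l i a ∈ D i)
    (_ : ∀ i < M, ∀ a ∈ A i, tile (F (n (l i a))) a ⊆ E)
    (_ : ∀ i < M, ((E \ A i).card : ℝ) ≤ δ * E.card),
    ∃ T : Finset (G × L),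
      (∀ q ∈ T, ∃ i < M, q.1 ∈ A i ∧ q.2 = l i q.1) ∧
      (1 - κ) * (∑ q ∈ T, ((F (n q.2)).card : ℝ)) ≤ E.card ∧
      ((E \ ltiles F n T).card : ℝ) ≤ η * E.card := by
  have h1κ : 0 < 1 - κ := by linarith
  set c := η / (2 * (1 / κ + C / (1 - κ))) with hc
  have hcpos : 0 < c := by positivity
  obtain ⟨M, hM⟩ := exists_nat_gt (1 / c)
  refine ⟨M, (1 - κ) * η / 4, by positivity, η / 4, by positivity, ?_⟩
  intro n D hD E A l hEne hAE hlD hlE hA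
  obtain ⟨T, hT1, hT2, hT3, hT4⟩ := greedy_multi F hne C hC hT n κ hκ0 hκ1 η _ _ hη le_rfl
    (by positivity) le_rfl M D hD E A l hAE hlD hlE hA M le_rfl
  have hUE : ((ltiles F n T).card : ℝ) ≤ E.card := by exact_mod_cast Finset.card_le_card hT3
  have hEpos : (0 : ℝ) < E.card := by exact_mod_cast hEne.card_pos
  refine ⟨T, fun q hq => ?_, hT2.trans hUE, ?_⟩
  · obtain ⟨i, hi, _, h⟩ := hT1 q hq
    exact ⟨i, hi, h⟩
  · have h1 : (1 - η) * E.card ≤ ((ltiles F n T).card : ℝ) := by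
      refine hT4.resolve_right fun h => ?_
      rw [← hc] at h
      rw [div_lt_iff₀ hcpos] at hM
      nlinarith
    rw [Finset.card_sdiff_of_subset hT3, Nat.cast_sub (Finset.card_le_card hT3)]
    linarith
end Comb2

open MeasureTheory Filter Set
open scoped Pointwise ENNReal NNReal Topology

section Folner
variable {G : Type*} [Group G] [DecidableEq G]

lemma folner_sum {F : ℕ → Finset G} (hF : IsFolnerSeq F) (K : Finset G) {δ : ℝ} (hδ : 0 < δ) :
    ∀ᶠ n in atTop, ∑ g ∈ K, ((symmDiff (F n) ((F n).image (g * ·))).card : ℝ)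
      ≤ δ * (F n).card := by
  have h : Tendsto (fun n => ∑ g ∈ K, ((symmDiff (F n) ((F n).image (g * ·))).card : ℝ) /
      (F n).card) atTop (𝓝 (∑ g ∈ K, 0)) := tendsto_finsetSum _ fun g _ => hF.2 g
  rw [Finset.sum_const_zero] at h
  filter_upwards [h.eventually (gt_mem_nhds hδ)] with n hn
  have hpos : (0 : ℝ) < (F n).card := by exact_mod_cast (hF.1 n).card_pos
  rw [← Finset.sum_div, div_lt_iff₀ hpos] at hn
  exact hn.le

lemma card_mul_sdiff_le (F K : Finset G) :
    (((K * F) \ F).card : ℝ) ≤ ∑ g ∈ K, ((symmDiff F (F.image (g * ·))).card : ℝ) := by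
  have : (K * F) \ F ⊆ K.biUnion (fun g => symmDiff F (F.image (g * ·))) := by
    intro a ha
    rw [Finset.mem_sdiff, Finset.mem_mul] at ha
    obtain ⟨⟨g, hg, f, hf, rfl⟩, h2⟩ := ha
    rw [Finset.mem_biUnion]
    exact ⟨g, hg, Finset.mem_symmDiff.2 (Or.inr ⟨Finset.mem_image_of_mem _ hf, h2⟩)⟩
  exact_mod_cast (Finset.card_le_card this).trans Finset.card_biUnion_le

lemma card_bdry_le (F K : Finset G) :
    ((F.filter (fun a => ∃ k ∈ K, k * a ∉ F)).card : ℝ)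
      ≤ ∑ g ∈ K, ((symmDiff F (F.image (g * ·))).card : ℝ) := by
  have : F.filter (fun a => ∃ k ∈ K, k * a ∉ F) ⊆
      K.biUnion (fun g => (symmDiff F (F.image (g * ·))).image (g⁻¹ * ·)) := by
    intro a ha
    rw [Finset.mem_filter] at ha
    obtain ⟨h1, g, hg, h2⟩ := ha
    rw [Finset.mem_biUnion]
    refine ⟨g, hg, Finset.mem_image.2 ⟨g * a, ?_, by simp⟩⟩
    exact Finset.mem_symmDiff.2 (Or.inr ⟨Finset.mem_image_of_mem _ h1, h2⟩)
  have h2 := (Finset.card_le_card this).trans (Finset.card_biUnion_le.trans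
    (Finset.sum_le_sum fun g _ => Finset.card_image_le))
  exact_mod_cast h2

lemma folner_mul_sdiff {F : ℕ → Finset G} (hF : IsFolnerSeq F) (K : Finset G) {δ : ℝ}
    (hδ : 0 < δ) : ∀ᶠ n in atTop, (((K * F n) \ F n).card : ℝ) ≤ δ * (F n).card := by
  filter_upwards [folner_sum hF K hδ] with n hn
  exact (card_mul_sdiff_le _ _).trans hn

lemma folner_bdry {F : ℕ → Finset G} (hF : IsFolnerSeq F) (K : Finset G) {δ : ℝ}
    (hδ : 0 < δ) :
    ∀ᶠ n in atTop, (((F n).filter (fun a => ∃ k ∈ K, k * a ∉ F n)).card : ℝ)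
      ≤ δ * (F n).card := by
  filter_upwards [folner_sum hF K hδ] with n hn
  exact (card_bdry_le _ _).trans hn

lemma card_tendsto {F : ℕ → Finset G} (hG : GrowthCond F) :
    Tendsto (fun n => ((F n).card : ℝ)) atTop atTop := by
  have hlog : Tendsto (fun n : ℕ => Real.log n) atTop atTop :=
    Real.tendsto_log_atTop.comp tendsto_natCast_atTop_atTop
  refine tendsto_atTop_mono' _ ?_ hlog
  filter_upwards [hG.eventually_ge_atTop 1, hlog.eventually_gt_atTop 0] with n h1 h2
  rwa [le_div_iff₀ h2, one_mul] at h1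
end Folner

section Counting

lemma count_tilings {G L : Type*} [DecidableEq G] [DecidableEq L] (w : L → ℝ) (E : Finset G)
    (D : Finset L) (s τ κ : ℝ) (hs : 0 ≤ s) (hκ : κ < 1)
    (hw : ∑ p ∈ D, Real.exp (-s * w p) ≤ τ) :
    (((E ×ˢ D).powerset.filter
      (fun T => (1 - κ) * (∑ q ∈ T, w q.2) ≤ E.card)).card : ℝ)
      ≤ Real.exp ((s / (1 - κ) + τ) * E.card) := by
  classical
  have h1κ : 0 < 1 - κ := by linarith
  set Q := (E ×ˢ D).powerset.filter (fun T => (1 - κ) * (∑ q ∈ T, w q.2) ≤ E.card) with hQ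
  have h1 : (Q.card : ℝ) * Real.exp (-(s / (1 - κ) * E.card)) ≤
      ∑ T ∈ Q, ∏ q ∈ T, Real.exp (-s * w q.2) := by
    rw [← nsmul_eq_mul]
    refine Finset.card_nsmul_le_sum _ _ _ fun T hT => ?_
    rw [← Real.exp_sum, ← Finset.mul_sum]
    apply Real.exp_le_exp.2
    have := (Finset.mem_filter.1 hT).2
    have h2 : ∑ q ∈ T, w q.2 ≤ E.card / (1 - κ) := by rw [le_div_iff₀ h1κ]; linarith
    have h3 := mul_le_mul_of_nonneg_left h2 hs
    have : s / (1 - κ) * E.card = s * (E.card / (1 - κ)) := by ring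
    rw [this]; linarith
  have h2 : ∑ T ∈ Q, ∏ q ∈ T, Real.exp (-s * w q.2) ≤ Real.exp (τ * E.card) := by
    calc ∑ T ∈ Q, ∏ q ∈ T, Real.exp (-s * w q.2)
        ≤ ∑ T ∈ (E ×ˢ D).powerset, ∏ q ∈ T, Real.exp (-s * w q.2) :=
          Finset.sum_le_sum_of_subset_of_nonneg (Finset.filter_subset _ _)
            fun _ _ _ => Finset.prod_nonneg fun _ _ => (Real.exp_pos _).le
      _ = ∏ q ∈ E ×ˢ D, (1 + Real.exp (-s * w q.2)) := (Finset.prod_one_add _).symm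
      _ ≤ ∏ q ∈ E ×ˢ D, Real.exp (Real.exp (-s * w q.2)) := by
          refine Finset.prod_le_prod (fun _ _ => by positivity) fun q _ => ?_
          rw [add_comm]; exact Real.add_one_le_exp _
      _ = Real.exp (∑ q ∈ E ×ˢ D, Real.exp (-s * w q.2)) := (Real.exp_sum _ _).symm
      _ ≤ Real.exp (τ * E.card) := by
          apply Real.exp_le_exp.2
          rw [Finset.sum_product]
          simp only [Finset.sum_const, nsmul_eq_mul]
          rw [mul_comm]
          gcongr
  have h3 : (Q.card : ℝ) = Q.card * Real.exp (-(s / (1 - κ) * E.card)) *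
      Real.exp (s / (1 - κ) * E.card) := by
    rw [mul_assoc, ← Real.exp_add]; simp
  rw [h3, add_mul, add_comm, Real.exp_add]
  gcongr
  exact h1.trans h2

lemma count_errors {I : Type*} [Fintype I] [DecidableEq I] (k : ℕ) (r ξ : ℝ) (hr : 0 ≤ r) :
    ((Finset.univ.filter (fun e : I → Option (Fin k) =>
      ((Finset.univ.filter (fun h => e h ≠ none)).card : ℝ) ≤ ξ * Fintype.card I)).card : ℝ)
      ≤ Real.exp ((k * Real.exp (-r) + ξ * r) * Fintype.card I) := by
  classical
  set Q := Finset.univ.filter (fun e : I → Option (Fin k) =>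
      ((Finset.univ.filter (fun h => e h ≠ none)).card : ℝ) ≤ ξ * Fintype.card I) with hQ
  let wt : Option (Fin k) → ℝ := fun o => if o ≠ none then Real.exp (-r) else 1
  have h1 : (Q.card : ℝ) * Real.exp (-(ξ * r * Fintype.card I)) ≤ ∑ e ∈ Q, ∏ h, wt (e h) := by
    rw [← nsmul_eq_mul]
    refine Finset.card_nsmul_le_sum _ _ _ fun e he => ?_
    have := (Finset.mem_filter.1 he).2
    simp only [wt]
    rw [← Finset.prod_filter, Finset.prod_const, ← Real.exp_nat_mul]
    apply Real.exp_le_exp.2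
    nlinarith [mul_le_mul_of_nonneg_right this hr]
  have h2 : ∑ e ∈ Q, ∏ h, wt (e h) ≤ Real.exp (k * Real.exp (-r) * Fintype.card I) := by
    calc ∑ e ∈ Q, ∏ h, wt (e h) ≤ ∑ e : I → Option (Fin k), ∏ h, wt (e h) :=
          Finset.sum_le_sum_of_subset_of_nonneg (Finset.filter_subset _ _)
            fun _ _ _ => Finset.prod_nonneg fun _ _ => by
              simp only [wt]; split_ifs <;> positivity
      _ = ∏ h : I, ∑ o : Option (Fin k), wt o := by
          rw [Finset.prod_univ_sum, Fintype.piFinset_univ]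
      _ = (1 + k * Real.exp (-r)) ^ Fintype.card I := by
          simp [wt, Fintype.sum_option]
      _ ≤ (Real.exp (k * Real.exp (-r))) ^ Fintype.card I := by
          gcongr; rw [add_comm]; exact Real.add_one_le_exp _
      _ = _ := by rw [← Real.exp_nat_mul, mul_comm]
  have h3 : (Q.card : ℝ) = Q.card * Real.exp (-(ξ * r * Fintype.card I)) *
      Real.exp (ξ * r * Fintype.card I) := by
    rw [mul_assoc, ← Real.exp_add]; simp
  rw [h3, add_mul, Real.exp_add]
  gcongr
  exact h1.trans h2

lemma negMulLog_le_gibbs {p q : ℝ} (hp : 0 ≤ p) (hq : 0 < q) :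
    Real.negMulLog p ≤ -p * Real.log q + q - p := by
  rcases hp.eq_or_lt with rfl | hp
  · simp; exact hq.le
  · have h1 := Real.log_le_sub_one_of_pos (div_pos hq hp)
    rw [Real.log_div hq.ne' hp.ne'] at h1
    have h2 := mul_le_mul_of_nonneg_left h1 hp.le
    have h3 : p * (q / p - 1) = q - p := by field_simp
    rw [h3] at h2
    rw [Real.negMulLog]
    linarith

lemma sum_negMulLog_le {J : Type*} (T : Finset J) (p : J → ℝ) (hp : ∀ j, 0 ≤ p j) :
    ∑ j ∈ T, Real.negMulLog (p j) ≤ (∑ j ∈ T, p j) * Real.log T.card + 1 - ∑ j ∈ T, p j := by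
  rcases T.eq_empty_or_nonempty with rfl | hT
  · simp
  have hc : (0 : ℝ) < T.card := by exact_mod_cast hT.card_pos
  calc ∑ j ∈ T, Real.negMulLog (p j)
      ≤ ∑ j ∈ T, (-p j * Real.log (1 / T.card) + 1 / T.card - p j) :=
        Finset.sum_le_sum fun j _ => negMulLog_le_gibbs (hp j) (by positivity)
    _ = _ := by
        rw [Finset.sum_sub_distrib, Finset.sum_add_distrib, ← Finset.sum_mul,
          Finset.sum_neg_distrib, Finset.sum_const, nsmul_eq_mul, one_div, Real.log_inv]
        rw [mul_inv_cancel₀ hc.ne']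
        ring

lemma entropy_bound {J : Type*} [Fintype J] [DecidableEq J] (p : J → ℝ) (hp : ∀ j, 0 ≤ p j)
    (hsum : ∑ j, p j ≤ 1) (S : Finset J) (L₁ L₂ ρ : ℝ) (hL₁ : 0 ≤ L₁) (hL₂ : 0 ≤ L₂)
    (hS : (S.card : ℝ) ≤ Real.exp L₁) (hJ : (Fintype.card J : ℝ) ≤ Real.exp L₂)
    (hρ : ∑ j ∈ Sᶜ, p j ≤ ρ) :
    ∑ j, Real.negMulLog (p j) ≤ L₁ + ρ * L₂ + 2 := by
  have hlog : ∀ (T : Finset J) (L : ℝ), 0 ≤ L → (T.card : ℝ) ≤ Real.exp L →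
      Real.log T.card ≤ L := by
    intro T L hL h
    rcases T.eq_empty_or_nonempty with rfl | hT
    · simpa using hL
    · have hc : (0 : ℝ) < T.card := by exact_mod_cast hT.card_pos
      rw [Real.log_le_iff_le_exp hc]; exact h
  have h1 := sum_negMulLog_le S p hp
  have h2 := sum_negMulLog_le Sᶜ p hp
  have hS0 : 0 ≤ ∑ j ∈ S, p j := Finset.sum_nonneg fun _ _ => hp _
  have hS0' : 0 ≤ ∑ j ∈ Sᶜ, p j := Finset.sum_nonneg fun _ _ => hp _
  have hadd := Finset.sum_add_sum_compl S p
  have hadd' := Finset.sum_add_sum_compl S (fun j => Real.negMulLog (p j))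
  have l1 := hlog S L₁ hL₁ hS
  have l2 := hlog Sᶜ L₂ hL₂ (le_trans (by exact_mod_cast Finset.card_le_univ _) hJ)
  have e1 : (∑ j ∈ S, p j) * Real.log S.card ≤ L₁ :=
    (mul_le_mul_of_nonneg_left l1 hS0).trans (by nlinarith)
  have e2 : (∑ j ∈ Sᶜ, p j) * Real.log Sᶜ.card ≤ ρ * L₂ :=
    (mul_le_mul_of_nonneg_left l2 hS0').trans (by gcongr)
  linarith
end Counting

open MeasureTheory Filter Set
open scoped Pointwise ENNReal NNReal Topology

section PartB
variable {G : Type*} [Group G] [DecidableEq G]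
  {X : Type*} [MetricSpace X] [CompactSpace X] [MulAction G X] [ContinuousConstSMul G X]
  [MeasurableSpace X] [BorelSpace X]

lemma exists_decoder (μ : Measure X) [IsProbabilityMeasure μ] {k : ℕ} (α : X → Fin k)
    (hα : Measurable α) {β : ℝ} (hβ : 0 < β) :
    ∃ B : Set X, MeasurableSet B ∧ μ B ≤ ENNReal.ofReal β ∧ ∃ ε > 0, ∃ dec : X → Fin k,
      ∀ y ∉ B, ∀ z, dist y z < ε → dec z = α y := by
  classical
  have : Nonempty X := by
    by_contra h
    rw [not_nonempty_iff] at h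
    have h1 : μ univ = 1 := measure_univ
    simp [univ_eq_empty_iff.2 h] at h1
  obtain ⟨x₀⟩ := this
  have hk : 0 < k := (α x₀).pos
  have hk' : (0 : ℝ) < k := by exact_mod_cast hk
  have h1 : ∀ i : Fin k, ∃ K ⊆ α ⁻¹' {i}, IsCompact K ∧
      μ (α ⁻¹' {i} \ K) < ENNReal.ofReal (β / k) := fun i =>
    (hα (measurableSet_singleton i)).exists_isCompact_sdiff_lt (measure_ne_top _ _)
      (by simpa using div_pos hβ hk')
  choose K hKs hKc hKm using h1
  have h2 : ∀ i j : Fin k, ∃ δ : ℝ, 0 < δ ∧ (i ≠ j →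
      Disjoint (Metric.thickening δ (K i)) (Metric.thickening δ (K j))) := by
    intro i j
    by_cases hij : i = j
    · exact ⟨1, one_pos, fun h => absurd hij h⟩
    · have hd : Disjoint (K i) (K j) := by
        refine Set.disjoint_of_subset (hKs i) (hKs j) ?_
        rw [Set.disjoint_left]
        intro a ha hb
        exact hij (ha.symm.trans hb)
      obtain ⟨δ, h, h'⟩ := hd.exists_thickenings (hKc i) (hKc j).isClosed
      exact ⟨δ, h, fun _ => h'⟩
  choose δ hδ0 hδ using h2
  have h3 : ∀ᶠ ε : ℝ in 𝓝[>] 0, ∀ i j, ε ≤ δ i j := by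
    rw [eventually_all]; intro i
    rw [eventually_all]; intro j
    exact (eventually_le_nhds (hδ0 i j)).filter_mono nhdsWithin_le_nhds
  obtain ⟨ε, hε, hε0⟩ := (h3.and self_mem_nhdsWithin).exists
  have hε0' : (0 : ℝ) < ε := hε0
  refine ⟨(⋃ i, K i)ᶜ, (MeasurableSet.iUnion fun i => (hKc i).isClosed.measurableSet).compl, ?_,
    ε, hε0', fun z => if h : ∃ i, z ∈ Metric.thickening ε (K i) then h.choose else α x₀, ?_⟩
  · have hsub : (⋃ i, K i)ᶜ ⊆ ⋃ i, (α ⁻¹' {i} \ K i) := by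
      intro x hx
      rw [mem_iUnion]
      refine ⟨α x, rfl, fun h => hx (mem_iUnion.2 ⟨_, h⟩)⟩
    calc μ (⋃ i, K i)ᶜ ≤ μ (⋃ i, (α ⁻¹' {i} \ K i)) := measure_mono hsub
      _ ≤ ∑ i, μ (α ⁻¹' {i} \ K i) := measure_iUnion_fintype_le _ _
      _ ≤ ∑ i : Fin k, ENNReal.ofReal (β / k) := Finset.sum_le_sum fun i _ => (hKm i).le
      _ = ENNReal.ofReal β := by
        rw [Finset.sum_const, Finset.card_univ, Fintype.card_fin, nsmul_eq_mul,
          ← ENNReal.ofReal_natCast, ← ENNReal.ofReal_mul hk'.le]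
        congr 1; field_simp
  · intro y hy z hyz
    rw [mem_compl_iff, not_not, mem_iUnion] at hy
    obtain ⟨i, hi⟩ := hy
    have hαi : α y = i := hKs i hi
    have hz : z ∈ Metric.thickening ε (K i) :=
      Metric.mem_thickening_iff.2 ⟨y, hi, by rwa [dist_comm]⟩
    have hex : ∃ i, z ∈ Metric.thickening ε (K i) := ⟨i, hz⟩
    simp only [dif_pos hex]
    rw [hαi]
    by_contra hne
    have hd := hδ _ _ hne
    exact Set.disjoint_left.1 hd (Metric.thickening_mono (hε _ _) _ hex.choose_spec)
      (Metric.thickening_mono (hε _ _) _ hz)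

lemma measurable_smulX (g : G) : Measurable (fun x : X => g • x) :=
  (continuous_const_smul g).measurable

lemma measure_preimage_smulX {μ : Measure X} (hinv : InvariantMeasure G μ) (g : G) {V : Set X}
    (hV : MeasurableSet V) : μ ((fun x => g • x) ⁻¹' V) = μ V := by
  conv_rhs => rw [← hinv g]
  rw [Measure.map_apply (measurable_smulX g) hV]

open Classical in
lemma markov_orbit {μ : Measure X} (hinv : InvariantMeasure G μ) {V : Set X}
    (hV : MeasurableSet V) (E : Finset G) (hE : E.Nonempty) {v t : ℝ} (ht : 0 < t)
    (hv : μ V ≤ ENNReal.ofReal v) :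
    μ {x | t * E.card < ((E.filter (fun a => a • x ∈ V)).card : ℝ)} ≤ ENNReal.ofReal (v / t) := by
  have hEc : (0 : ℝ) < E.card := by exact_mod_cast hE.card_pos
  set f : X → ℝ≥0∞ := fun x => ∑ a ∈ E, ((fun x => a • x) ⁻¹' V).indicator 1 x with hf
  have hfx : ∀ x, f x = ENNReal.ofReal ((E.filter (fun a => a • x ∈ V)).card : ℝ) := by
    intro x
    rw [ENNReal.ofReal_natCast, Finset.card_filter, hf]
    push_cast
    refine Finset.sum_congr rfl fun a _ => ?_
    by_cases h : a • x ∈ V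
    · rw [Set.indicator_of_mem (by exact h)]; simp [h]
    · rw [Set.indicator_of_notMem (by exact h)]; simp [h]
  have hmeas : ∀ a ∈ E, Measurable (((fun x : X => a • x) ⁻¹' V).indicator (1 : X → ℝ≥0∞)) :=
    fun a _ => measurable_one.indicator (measurable_smulX a hV)
  have hIntg : ∫⁻ x, f x ∂μ ≤ E.card * ENNReal.ofReal v := by
    rw [hf, lintegral_finsetSum _ hmeas]
    rw [← nsmul_eq_mul]
    refine Finset.sum_le_card_nsmul _ _ _ fun a _ => ?_
    rw [lintegral_indicator_one (measurable_smulX a hV), measure_preimage_smulX hinv a hV]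
    exact hv
  have hm := mul_meas_ge_le_lintegral (μ := μ) (f := f) (Finset.measurable_fun_sum _ hmeas)
    (ENNReal.ofReal (t * E.card))
  have hsub : {x | t * E.card < ((E.filter (fun a => a • x ∈ V)).card : ℝ)} ⊆
      {x | ENNReal.ofReal (t * E.card) ≤ f x} := by
    intro x hx
    rw [mem_ofPred_eq, hfx]
    exact ENNReal.ofReal_le_ofReal (le_of_lt hx)
  refine (measure_mono hsub).trans ?_
  have h2 := hm.trans hIntg
  have hpos : 0 < t * E.card := by positivity
  rw [ENNReal.ofReal_div_of_pos ht]
  rw [ENNReal.le_div_iff_mul_le (Or.inl (by simpa using ht)) (Or.inl ENNReal.ofReal_ne_top)]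
  have hE0 : (E.card : ℝ≥0∞) ≠ 0 := by exact_mod_cast hE.card_pos.ne'
  rw [ENNReal.ofReal_mul ht.le, ENNReal.ofReal_natCast] at h2 ⊢
  rw [← ENNReal.mul_le_mul_iff_right hE0 (ENNReal.natCast_ne_top _)]
  calc _ = _ := by ring
    _ ≤ _ := h2

lemma bowenBall_isOpen (F : Finset G) (x : X) (ε : ℝ) : IsOpen (bowenBall F x ε) := by
  have : bowenBall F x ε = ⋂ g ∈ F, {y | dist (g • x) (g • y) < ε} := by
    ext y; simp [bowenBall]
  rw [this]
  exact isOpen_biInter_finset fun g _ =>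
    isOpen_lt (continuous_const.dist (continuous_const_smul g)) continuous_const
end PartB

set_option linter.unusedSectionVars false
set_option linter.unusedVariables false
open MeasureTheory Filter Set
open scoped Pointwise ENNReal NNReal Topology

section PartB2
variable {G : Type*} [Group G] [DecidableEq G]
  {X : Type*} [MetricSpace X] [CompactSpace X] [MulAction G X] [ContinuousConstSMul G X]
  [MeasurableSpace X] [BorelSpace X]

open Classical in
/-- Decoding of a name from a family of labelled tiles. -/
noncomputable def valT (F : ℕ → Finset G) {k : ℕ} (dec : X → Fin k) (v₀ : Fin k)
    (T : Finset (G × (X × ℕ))) (h : G) : Fin k :=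
  if hq : ∃ q ∈ T, h ∈ tile (F q.2.2) q.1 then
    dec ((h * hq.choose.1⁻¹) • hq.choose.2.1) else v₀

lemma valT_eq (F : ℕ → Finset G) {k : ℕ} (α dec : X → Fin k) (v₀ : Fin k)
    (T : Finset (G × (X × ℕ))) (B : Set X) (ε : ℝ)
    (hdec : ∀ y ∉ B, ∀ z, dist y z < ε → dec z = α y) (x : X)
    (hT : ∀ q ∈ T, q.1 • x ∈ bowenBall (F q.2.2) q.2.1 ε) (h : G)
    (hh : h ∈ ltiles F (fun p : X × ℕ => p.2) T) (hB : h • x ∉ B) :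
    valT F dec v₀ T h = α (h • x) := by
  have hq : ∃ q ∈ T, h ∈ tile (F q.2.2) q.1 := by
    simpa only [ltiles, Finset.mem_biUnion] using hh
  rw [valT, dif_pos hq]
  obtain ⟨h1, h2⟩ := hq.choose_spec
  refine hdec _ hB _ ?_
  have h3 := hT _ h1 _ (mem_tile.1 h2)
  rw [smul_smul] at h3
  rw [dist_comm]
  simpa using h3

open Classical in
lemma decode_exists (F : ℕ → Finset G) {k : ℕ} (α dec : X → Fin k) (v₀ : Fin k)
    (B : Set X) (ε ξ : ℝ) (hdec : ∀ y ∉ B, ∀ z, dist y z < ε → dec z = α y) (x : X)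
    (T : Finset (G × (X × ℕ))) (E : Finset G)
    (hT : ∀ q ∈ T, q.1 • x ∈ bowenBall (F q.2.2) q.2.1 ε)
    (hcov : ((E \ ltiles F (fun p : X × ℕ => p.2) T).card : ℝ) ≤ ξ / 2 * E.card)
    (hB : ((E.filter (fun a => a • x ∈ B)).card : ℝ) ≤ ξ / 2 * E.card) :
    ∃ e : ↥E → Option (Fin k),
      ((Finset.univ.filter (fun h => e h ≠ none)).card : ℝ) ≤ ξ * Fintype.card ↥E ∧
      ∀ h : ↥E, α ((h : G) • x) = (e h).getD (valT F dec v₀ T h) := by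
  refine ⟨fun h => if valT F dec v₀ T h = α ((h : G) • x) then none else some (α ((h : G) • x)),
    ?_, ?_⟩
  · have hsub : (Finset.univ.filter (fun h : ↥E => (if valT F dec v₀ T h = α ((h : G) • x) then none
        else some (α ((h : G) • x))) ≠ none)).image (fun h : ↥E => (h : G)) ⊆
        (E \ ltiles F (fun p : X × ℕ => p.2) T) ∪ E.filter (fun a => a • x ∈ B) := by
      intro h hh
      rw [Finset.mem_image] at hh
      obtain ⟨h', hh', rfl⟩ := hh
      rw [Finset.mem_filter] at hh'
      have hne : valT F dec v₀ T h' ≠ α ((h' : G) • x) := by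
        intro hcon; simp [hcon] at hh'
      rw [Finset.mem_union, Finset.mem_sdiff, Finset.mem_filter]
      by_contra hcon
      push Not at hcon
      exact hne (valT_eq F α dec v₀ T B ε hdec x hT _ (hcon.1 h'.2) (hcon.2 h'.2))
    have h1 := (Finset.card_le_card hsub).trans (Finset.card_union_le _ _)
    rw [Finset.card_image_of_injective _ Subtype.val_injective] at h1
    rw [Fintype.card_coe]
    refine le_trans (Nat.cast_le.2 h1) ?_
    push_cast
    linarith
  · intro h
    by_cases hc : valT F dec v₀ T h = α ((h : G) • x)
    · simp [hc]
    · simp [hc]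

lemma sum_partition_eq (μ : Measure X) [IsProbabilityMeasure μ] {k : ℕ} (α : X → Fin k)
    (hα : Measurable α) (E : Finset G) (S : Finset (↥E → Fin k)) :
    ∑ f ∈ S, (μ {x | ∀ g : ↥E, α ((g : G) • x) = f g}).toReal =
      (μ {x | (fun g : ↥E => α ((g : G) • x)) ∈ S}).toReal := by
  have hm : Measurable (fun x : X => fun g : ↥E => α ((g : G) • x)) :=
    measurable_pi_lambda _ fun g => hα.comp (measurable_smulX (g : G))
  have h := sum_measure_preimage_singleton (μ := μ) S
    (f := fun x : X => fun g : ↥E => α ((g : G) • x)) (fun y _ => hm (measurableSet_singleton y))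
  have h2 : ∀ f : ↥E → Fin k, {x | ∀ g : ↥E, α ((g : G) • x) = f g} =
      (fun x : X => fun g : ↥E => α ((g : G) • x)) ⁻¹' {f} := by
    intro f; ext x; simp [funext_iff]
  rw [← ENNReal.toReal_sum (fun _ _ => measure_ne_top _ _)]
  congr 1
  simp only [h2]
  rw [h]; rfl

lemma k_pos (μ : Measure X) [IsProbabilityMeasure μ] {k : ℕ} (α : X → Fin k) : 0 < k := by
  have : Nonempty X := by
    by_contra h
    rw [not_nonempty_iff] at h
    have h1 : μ univ = 1 := measure_univ
    simp [univ_eq_empty_iff.2 h] at h1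
  obtain ⟨x₀⟩ := this
  exact (α x₀).pos

lemma entropy_le_of_names (μ : Measure X) [IsProbabilityMeasure μ] {k : ℕ} (α : X → Fin k)
    (hα : Measurable α) (E : Finset G) (S : Finset (↥E → Fin k)) (L₁ ρ : ℝ) (hρ : 0 ≤ ρ)
    (hL₁ : 0 ≤ L₁) (hS : (S.card : ℝ) ≤ Real.exp L₁) (Bad : Set X)
    (hBad : μ Bad ≤ ENNReal.ofReal ρ)
    (hgood : ∀ x ∉ Bad, (fun g : ↥E => α ((g : G) • x)) ∈ S) :
    partitionEntropy μ α E ≤ L₁ + ρ * (Real.log k * E.card) + 2 := by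
  classical
  have hk : (0 : ℝ) < k := by exact_mod_cast k_pos μ α
  have hk1 : (1 : ℝ) ≤ k := by exact_mod_cast k_pos μ α
  rw [partitionEntropy]
  have hL₂ : 0 ≤ Real.log k * E.card := mul_nonneg (Real.log_nonneg hk1) (Nat.cast_nonneg _)
  refine entropy_bound (fun f : ↥E → Fin k => (μ {x | ∀ g : ↥E, α ((g : G) • x) = f g}).toReal)
    (fun _ => ENNReal.toReal_nonneg) ?_ S L₁ (Real.log k * E.card) ρ hL₁ hL₂ hS ?_ ?_
  · rw [sum_partition_eq μ α hα]
    simp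
  · rw [Fintype.card_fun, Fintype.card_fin, Fintype.card_coe]
    push_cast
    rw [mul_comm, Real.exp_nat_mul, Real.exp_log hk]
  · rw [sum_partition_eq μ α hα]
    refine ENNReal.toReal_le_of_le_ofReal hρ ((measure_mono ?_).trans hBad)
    intro x hx
    by_contra hcon
    have := hgood x hcon
    simp only [Finset.mem_compl] at hx
    exact hx this

lemma sum_biUnion_le_aux {ι L : Type*} [DecidableEq L] (s : Finset ι) (D : ι → Finset L)
    (f : L → ℝ) (hf : ∀ p, 0 ≤ f p) : ∑ p ∈ s.biUnion D, f p ≤ ∑ i ∈ s, ∑ p ∈ D i, f p := by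
  classical
  induction s using Finset.induction_on with
  | empty => simp
  | insert a s ha ih =>
    rw [Finset.biUnion_insert, Finset.sum_insert ha]
    have := Finset.sum_union_inter (s₁ := D a) (s₂ := s.biUnion D) (f := f)
    have h0 : 0 ≤ ∑ p ∈ D a ∩ s.biUnion D, f p := Finset.sum_nonneg fun _ _ => hf _
    linarith

lemma exists_scales {F : ℕ → Finset G} (hF : IsFolnerSeq F) (Dn : ℕ → Finset (X × ℕ))
    (hDn : ∀ N, ∀ p ∈ Dn N, N ≤ p.2) {κ' : ℝ} (hκ' : 0 < κ') :
    ∃ N : ℕ → ℕ, ∀ i j, j < i → ∀ p ∈ Dn (N i),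
      (((((Dn (N j)).biUnion fun q => F q.2)⁻¹ * F p.2) \ F p.2).card : ℝ)
        ≤ κ' * (F p.2).card := by
  have h1 : ∀ N, ∃ N', ∀ n ≥ N', (((((Dn N).biUnion fun q => F q.2)⁻¹ * F n) \ F n).card : ℝ)
        ≤ κ' * (F n).card := fun N =>
    eventually_atTop.1 (folner_mul_sdiff hF _ hκ')
  choose next hnext using h1
  let Ns : ℕ → ℕ := fun i => Nat.rec 0 (fun _ N => max N (next N)) i
  have hs : ∀ i, Ns (i + 1) = max (Ns i) (next (Ns i)) := fun i => rfl
  have hmono : Monotone Ns := monotone_nat_of_le_succ fun i => by rw [hs]; exact le_max_left _ _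
  refine ⟨Ns, fun i j hji p hp => hnext _ _ ?_⟩
  have h2 : Ns (j + 1) ≤ Ns i := hmono hji
  rw [hs] at h2
  exact (le_max_right _ _).trans (h2.trans (hDn _ p hp))
end PartB2

set_option linter.unusedSectionVars false
set_option linter.unusedVariables false
open MeasureTheory Filter Set
open scoped Pointwise ENNReal NNReal Topology

section PartB3
variable {G : Type*} [Group G] [DecidableEq G]
  {X : Type*} [MetricSpace X] [CompactSpace X] [MulAction G X] [ContinuousConstSMul G X]
  [MeasurableSpace X] [BorelSpace X]

lemma entropy_le_of_covers (F : ℕ → Finset G) (hFol : IsFolnerSeq F) (hTemp : IsTemperedSeq F)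
    (hGrow : GrowthCond F) (μ : Measure X) [IsProbabilityMeasure μ] (hinv : InvariantMeasure G μ)
    (s : ℝ) (hs : 0 < s)
    (hcover : ∀ ε > 0, ∀ N : ℕ, ∀ τ > 0, ∀ δ > 0, ∃ D : Finset (X × ℕ), (∀ p ∈ D, N ≤ p.2) ∧
      ∑ p ∈ D, Real.exp (-s * ((F p.2).card : ℝ)) ≤ τ ∧
      μ (⋃ p ∈ D, bowenBall (F p.2) p.1 ε)ᶜ ≤ ENNReal.ofReal δ)
    {k : ℕ} (α : X → Fin k) (hα : Measurable α) (θ : ℝ) (hθ : 0 < θ) :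
    ∀ᶠ m in atTop, partitionEntropy μ α (F m) ≤ (s + θ) * (F m).card := by
  classical
  obtain ⟨C', hC'⟩ := hTemp
  set C := max C' 0 with hCdef
  have hC0 : 0 ≤ C := le_max_right _ _
  have hC : ∀ n : ℕ, (((Finset.range n).biUnion fun k => (F k)⁻¹ * F n).card : ℝ)
      ≤ C * (F n).card := fun n => (hC' n).trans (by gcongr; exact le_max_left _ _)
  have hne := hFol.1
  have hk : 0 < k := k_pos μ α
  have hk1 : (1 : ℝ) ≤ k := by exact_mod_cast hk
  have hlogk : 0 ≤ Real.log k := Real.log_nonneg hk1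
  -- parameters
  set κ := θ / (8 * (s + θ)) with hκ
  have hκ0 : 0 < κ := by positivity
  have hκ8 : κ * (s + θ) = θ / 8 := by rw [hκ]; field_simp
  have hκ1 : κ < 1 := by
    rw [hκ, div_lt_one (by positivity)]; linarith
  have hsκ : s / (1 - κ) ≤ s + θ / 8 := by
    rw [div_le_iff₀ (by linarith)]; nlinarith
  obtain ⟨r, hr0, hr⟩ : ∃ r : ℝ, 0 ≤ r ∧ k * Real.exp (-r) ≤ θ / 8 := by
    have h : Tendsto (fun r : ℝ => (k : ℝ) * Real.exp (-r)) atTop (𝓝 (k * 0)) :=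
      (Real.tendsto_exp_neg_atTop_nhds_zero).const_mul _
    rw [mul_zero] at h
    obtain ⟨r, h1, h2⟩ := ((h.eventually (ge_mem_nhds (show 0 < θ / 8 by positivity))).and
      (eventually_ge_atTop 0)).exists
    exact ⟨r, h2, h1⟩
  set ξ := θ / (8 * (r + 1)) with hξ
  have hξ0 : 0 < ξ := by positivity
  have hξr : ξ * r ≤ θ / 8 := by
    have : ξ * (r + 1) = θ / 8 := by rw [hξ]; field_simp
    nlinarith
  obtain ⟨M, κ', hκ', δ, hδ, hmulti⟩ := greedy_multi' (L := X × ℕ) F hne C hC0 hC κ hκ0 hκ1 (ξ / 2)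
    (by positivity)
  set ρ := θ / (8 * (Real.log k + 1)) with hρ
  have hρ0 : 0 < ρ := by positivity
  have hρk : ρ * Real.log k ≤ θ / 8 := by
    have : ρ * (Real.log k + 1) = θ / 8 := by rw [hρ]; field_simp
    nlinarith
  have hM0 : (0 : ℝ) < M + 1 := by positivity
  obtain ⟨B, hBm, hμB, ε, hε, dec, hdec⟩ := exists_decoder μ α hα
    (show 0 < ρ / 2 * (ξ / 2) by positivity)
  have hcov' := fun N => hcover ε hε N (θ / 8 / (M + 1)) (by positivity)
    (ρ / (2 * (M + 1)) * (δ / 2)) (by positivity)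
  choose Dn hDn1 hDn2 hDn3 using hcov'
  obtain ⟨Ns, hNs⟩ := exists_scales hFol Dn hDn1 hκ'
  set D : ℕ → Finset (X × ℕ) := fun i => Dn (Ns i) with hD
  set W : ℕ → Set X := fun i => ⋃ p ∈ D i, bowenBall (F p.2) p.1 ε with hW
  have hWm : ∀ i, MeasurableSet (W i) := fun i =>
    Finset.measurableSet_biUnion _ fun p _ => (bowenBall_isOpen _ _ _).measurableSet
  set DD := (Finset.range M).biUnion D with hDD
  have hDDsum : ∑ p ∈ DD, Real.exp (-s * ((F p.2).card : ℝ)) ≤ θ / 8 := by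
    refine (sum_biUnion_le_aux _ _ _ fun _ => (Real.exp_pos _).le).trans ?_
    calc ∑ i ∈ Finset.range M, ∑ p ∈ D i, Real.exp (-s * ((F p.2).card : ℝ))
        ≤ ∑ i ∈ Finset.range M, θ / 8 / (M + 1) := Finset.sum_le_sum fun i _ => hDn2 _
      _ = M / (M + 1) * (θ / 8) := by
          rw [Finset.sum_const, Finset.card_range, nsmul_eq_mul]; ring
      _ ≤ 1 * (θ / 8) := by
          gcongr
          rw [div_le_one hM0]; linarith
      _ = _ := one_mul _
  set K : ℕ → Finset G := fun i => (D i).biUnion fun q => F q.2 with hK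
  have hev1 : ∀ᶠ m in atTop, ∀ i ∈ Finset.range M,
      (((F m).filter (fun a => ∃ k ∈ K i, k * a ∉ F m)).card : ℝ) ≤ δ / 2 * (F m).card := by
    rw [Filter.eventually_all_finset]
    exact fun i _ => folner_bdry hFol (K i) (by positivity)
  have hev2 := (card_tendsto hGrow).eventually_ge_atTop (16 / θ)
  filter_upwards [hev1, hev2] with m hm1 hm2
  set E := F m with hE
  have hEne : E.Nonempty := hne m
  -- bad set
  set Bad₀ : Set X := {x | ξ / 2 * E.card < ((E.filter (fun a => a • x ∈ B)).card : ℝ)} with hBad₀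
  set Bad₁ : ℕ → Set X := fun i =>
    {x | δ / 2 * E.card < ((E.filter (fun a => a • x ∈ (W i)ᶜ)).card : ℝ)} with hBad₁
  set Bad : Set X := Bad₀ ∪ ⋃ i ∈ Finset.range M, Bad₁ i with hBad
  have hμ0 : μ Bad₀ ≤ ENNReal.ofReal (ρ / 2) := by
    refine (markov_orbit hinv hBm E hEne (by positivity) hμB).trans (le_of_eq ?_)
    congr 1; field_simp
  have hμ1 : ∀ i, μ (Bad₁ i) ≤ ENNReal.ofReal (ρ / (2 * (M + 1))) := by
    intro i
    have h1 := markov_orbit (t := δ / 2) hinv (hWm i).compl E hEne (by positivity) (hDn3 (Ns i))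
    have h2 : ρ / (2 * (M + 1)) * (δ / 2) / (δ / 2) = ρ / (2 * (M + 1)) := by field_simp
    rw [h2] at h1
    convert h1 using 8
  have hμBad : μ Bad ≤ ENNReal.ofReal ρ := by
    calc μ Bad ≤ μ Bad₀ + ∑ i ∈ Finset.range M, μ (Bad₁ i) :=
          (measure_union_le _ _).trans (by gcongr; exact measure_biUnion_finset_le _ _)
      _ ≤ ENNReal.ofReal (ρ / 2) + ∑ i ∈ Finset.range M, ENNReal.ofReal (ρ / (2 * (M + 1))) := by
          gcongr with i hi
          exact hμ1 i
      _ = ENNReal.ofReal (ρ / 2 + M * (ρ / (2 * (M + 1)))) := by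
          rw [Finset.sum_const, Finset.card_range, nsmul_eq_mul, ENNReal.ofReal_add (by positivity)
            (by positivity), ENNReal.ofReal_mul (by positivity), ENNReal.ofReal_natCast]
      _ ≤ ENNReal.ofReal ρ := by
          apply ENNReal.ofReal_le_ofReal
          have : M * (ρ / (2 * (M + 1))) = M / (M + 1) * (ρ / 2) := by field_simp
          have h2 : (M : ℝ) / (M + 1) ≤ 1 := by rw [div_le_one hM0]; linarith
          rw [this]; nlinarith
  -- the names
  let v₀ : Fin k := ⟨0, hk⟩
  set Q₁ := (E ×ˢ DD).powerset.filter
      (fun T => (1 - κ) * (∑ q ∈ T, ((F q.2.2).card : ℝ)) ≤ E.card) with hQ₁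
  set Q₂ := Finset.univ.filter (fun e : ↥E → Option (Fin k) =>
      ((Finset.univ.filter (fun h => e h ≠ none)).card : ℝ) ≤ ξ * Fintype.card ↥E) with hQ₂
  have hc1 := count_tilings (fun p : X × ℕ => ((F p.2).card : ℝ)) E DD s (θ / 8) κ hs.le hκ1 hDDsum
  have hc2 := count_errors (I := ↥E) k r ξ hr0
  rw [← hQ₂] at hc2
  set S : Finset (↥E → Fin k) := (Q₁ ×ˢ Q₂).image
    (fun z => fun h : ↥E => (z.2 h).getD (valT F dec v₀ z.1 h)) with hS
  have hScard : (S.card : ℝ) ≤ Real.exp ((s + θ / 2) * E.card) := by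
    have h1 : (S.card : ℝ) ≤ Q₁.card * Q₂.card := by
      have := (Finset.card_image_le (s := Q₁ ×ˢ Q₂)
        (f := fun z => fun h : ↥E => (z.2 h).getD (valT F dec v₀ z.1 h)))
      rw [Finset.card_product] at this
      exact_mod_cast this
    refine h1.trans ?_
    calc (Q₁.card : ℝ) * Q₂.card ≤ Real.exp ((s / (1 - κ) + θ / 8) * E.card) *
          Real.exp ((k * Real.exp (-r) + ξ * r) * Fintype.card ↥E) := by
            gcongr
      _ = Real.exp ((s / (1 - κ) + θ / 8 + (k * Real.exp (-r) + ξ * r)) * E.card) := by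
          rw [← Real.exp_add, Fintype.card_coe]; congr 1; ring
      _ ≤ _ := by
          apply Real.exp_le_exp.2
          have h9 : s / (1 - κ) + θ / 8 + (k * Real.exp (-r) + ξ * r) ≤ s + θ / 2 := by linarith
          exact mul_le_mul_of_nonneg_right h9 (Nat.cast_nonneg _)
  have hgood : ∀ x ∉ Bad, (fun g : ↥E => α ((g : G) • x)) ∈ S := by
    intro x hx
    have hx0 : ((E.filter (fun a => a • x ∈ B)).card : ℝ) ≤ ξ / 2 * E.card := by
      by_contra hcon
      push Not at hcon
      exact hx (Or.inl hcon)
    have hx1 : ∀ i < M, ((E.filter (fun a => a • x ∈ (W i)ᶜ)).card : ℝ) ≤ δ / 2 * E.card := by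
      intro i hi
      by_contra hcon
      push Not at hcon
      exact hx (Or.inr (mem_iUnion₂.2 ⟨i, Finset.mem_range.2 hi, hcon⟩))
    have hl : ∀ (i : ℕ) (a : G), ∃ p : X × ℕ, a • x ∈ W i → p ∈ D i ∧ a • x ∈ bowenBall (F p.2) p.1 ε := by
      intro i a
      by_cases h : a • x ∈ W i
      · obtain ⟨p, hp, hp'⟩ := mem_iUnion₂.1 h
        exact ⟨p, fun _ => ⟨hp, hp'⟩⟩
      · exact ⟨(x, 0), fun h' => absurd h' h⟩
    choose l hl using hl
    set A : ℕ → Finset G := fun i => E.filter (fun a => a • x ∈ W i ∧ ¬ ∃ k ∈ K i, k * a ∉ E) with hA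
    obtain ⟨T, hT1, hT2, hT3⟩ := hmulti (fun p => p.2) D hNs E A l hEne
      (fun i _ => Finset.filter_subset _ _)
      (fun i _ a ha => (hl i a (Finset.mem_filter.1 ha).2.1).1)
      (by
        intro i _ a ha b hb
        obtain ⟨h1, h2, h3⟩ := Finset.mem_filter.1 ha
        push Not at h3
        have := h3 (b * a⁻¹) (Finset.mem_biUnion.2 ⟨_, (hl i a h2).1, mem_tile.1 hb⟩)
        simpa using this)
      (by
        intro i hi
        have hsub : E \ A i ⊆ E.filter (fun a => a • x ∈ (W i)ᶜ) ∪
            E.filter (fun a => ∃ k ∈ K i, k * a ∉ E) := by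
          intro a ha
          rw [Finset.mem_sdiff] at ha
          rw [Finset.mem_union, Finset.mem_filter, Finset.mem_filter]
          by_contra hcon
          push Not at hcon
          refine ha.2 (Finset.mem_filter.2 ⟨ha.1, ?_, ?_⟩)
          · have := hcon.1 ha.1
            simpa using this
          · have := hcon.2 ha.1
            push Not
            exact this
        have h1 := (Finset.card_le_card hsub).trans (Finset.card_union_le _ _)
        refine le_trans (Nat.cast_le.2 h1) ?_
        push_cast
        have := hx1 i hi
        have := hm1 i (Finset.mem_range.2 hi)
        linarith)
    have hTball : ∀ q ∈ T, q.1 • x ∈ bowenBall (F q.2.2) q.2.1 ε := by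
      intro q hq
      obtain ⟨i, hi, h1, h2⟩ := hT1 q hq
      rw [h2]
      exact (hl i _ (Finset.mem_filter.1 h1).2.1).2
    obtain ⟨e, he1, he2⟩ := decode_exists F α dec v₀ B ε ξ hdec x T E hTball hT3 hx0
    rw [hS, Finset.mem_image]
    refine ⟨(T, e), Finset.mem_product.2 ⟨?_, ?_⟩, ?_⟩
    · rw [hQ₁, Finset.mem_filter, Finset.mem_powerset]
      refine ⟨fun q hq => ?_, hT2⟩
      obtain ⟨i, hi, h1, h2⟩ := hT1 q hq
      rw [Finset.mem_product]
      refine ⟨(Finset.mem_filter.1 h1).1, Finset.mem_biUnion.2 ⟨i, Finset.mem_range.2 hi, ?_⟩⟩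
      rw [h2]
      exact (hl i _ (Finset.mem_filter.1 h1).2.1).1
    · rw [hQ₂, Finset.mem_filter]
      refine ⟨Finset.mem_univ _, ?_⟩
      convert he1
    · funext h
      exact (he2 h).symm
  have hfin := entropy_le_of_names μ α hα E S ((s + θ / 2) * E.card) ρ hρ0.le (by positivity)
    hScard Bad hμBad hgood
  have hEc : 16 / θ ≤ (E.card : ℝ) := hm2
  rw [div_le_iff₀ hθ] at hEc
  have hEc0 : (0 : ℝ) ≤ E.card := by positivity
  have : ρ * (Real.log k * E.card) ≤ θ / 8 * E.card := by
    rw [← mul_assoc]; gcongr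
  linarith
end PartB3

set_option linter.unusedSectionVars false
set_option linter.unusedVariables false
open MeasureTheory Filter Set
open scoped Pointwise ENNReal NNReal Topology

section PartB4
variable {G : Type*} [Group G] [DecidableEq G]
  {X : Type*} [MetricSpace X] [CompactSpace X] [MulAction G X] [ContinuousConstSMul G X]
  [MeasurableSpace X] [BorelSpace X]

lemma cover_of_finite (F : ℕ → Finset G) (hGrow : GrowthCond F) (μ : Measure X)
    [IsProbabilityMeasure μ] (Z : Set X) (hZ : μ Zᶜ = 0) (s₀ s : ℝ) (hs : s₀ < s)
    (hfin : bowenMeasure F Z s₀ ≠ ⊤) :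
    ∀ ε > 0, ∀ N : ℕ, ∀ τ > 0, ∀ δ > 0, ∃ D : Finset (X × ℕ), (∀ p ∈ D, N ≤ p.2) ∧
      ∑ p ∈ D, Real.exp (-s * ((F p.2).card : ℝ)) ≤ τ ∧
      μ (⋃ p ∈ D, bowenBall (F p.2) p.1 ε)ᶜ ≤ ENNReal.ofReal δ := by
  classical
  intro ε hε N τ hτ δ hδ
  set c := (bowenMeasure F Z s₀).toReal with hc
  have hc0 : 0 ≤ c := ENNReal.toReal_nonneg
  -- choose L
  obtain ⟨L, hL⟩ : ∃ L : ℝ, Real.exp (-((s - s₀) * L)) * (c + 1) ≤ τ := by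
    have h1 : Tendsto (fun L : ℝ => (s - s₀) * L) atTop atTop :=
      tendsto_id.const_mul_atTop (sub_pos.2 hs)
    have h2 := (Real.tendsto_exp_neg_atTop_nhds_zero.comp h1).mul_const (c + 1)
    rw [zero_mul] at h2
    obtain ⟨L, hL⟩ := (h2.eventually (ge_mem_nhds hτ)).exists
    exact ⟨L, hL⟩
  obtain ⟨N₁, hN₁⟩ := eventually_atTop.1 ((card_tendsto hGrow).eventually_ge_atTop L)
  have hlt : bowenMpre F Z (max N N₁) ε s₀ < ENNReal.ofReal (c + 1) := by
    have h1 : bowenMpre F Z (max N N₁) ε s₀ ≤ bowenMeasure F Z s₀ :=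
      le_trans (le_iSup (fun N => bowenMpre F Z N ε s₀) _)
        (le_iSup₂ (f := fun (ε : ℝ) (_ : 0 < ε) => ⨆ N : ℕ, bowenMpre F Z N ε s₀) ε hε)
    refine h1.trans_lt ?_
    rw [← ENNReal.ofReal_toReal hfin]
    exact (ENNReal.ofReal_lt_ofReal_iff (by positivity)).2 (by linarith)
  unfold bowenMpre at hlt
  obtain ⟨C, hC⟩ := iInf_lt_iff.1 hlt
  obtain ⟨⟨hCc, hCN, hCZ⟩, hsum⟩ := iInf_lt_iff.1 hC
  have hsumfin : ∀ D : Finset (X × ℕ), (D : Set (X × ℕ)) ⊆ C →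
      ∑ p ∈ D, Real.exp (-s * ((F p.2).card : ℝ)) ≤ τ := by
    intro D hD
    have h1 : ∑ p ∈ D, ENNReal.ofReal (Real.exp (-s₀ * ((F p.2).card : ℝ))) ≤
        ENNReal.ofReal (c + 1) := by
      refine le_trans ?_ hsum.le
      rw [← Finset.tsum_subtype]
      exact ENNReal.tsum_mono_subtype
        (fun p : X × ℕ => ENNReal.ofReal (Real.exp (-s₀ * ((F p.2).card : ℝ)))) hD
    rw [← ENNReal.ofReal_sum_of_nonneg (fun _ _ => (Real.exp_pos _).le),
      ENNReal.ofReal_le_ofReal_iff (by positivity)] at h1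
    calc ∑ p ∈ D, Real.exp (-s * ((F p.2).card : ℝ))
        ≤ ∑ p ∈ D, Real.exp (-((s - s₀) * L)) * Real.exp (-s₀ * ((F p.2).card : ℝ)) := by
          refine Finset.sum_le_sum fun p hp => ?_
          rw [← Real.exp_add]
          apply Real.exp_le_exp.2
          have h2 := hN₁ p.2 ((le_max_right _ _).trans (hCN p (hD hp)))
          have h3 := mul_le_mul_of_nonneg_left h2 (sub_pos.2 hs).le
          linarith
      _ = Real.exp (-((s - s₀) * L)) * ∑ p ∈ D, Real.exp (-s₀ * ((F p.2).card : ℝ)) := by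
          rw [Finset.mul_sum]
      _ ≤ Real.exp (-((s - s₀) * L)) * (c + 1) := by gcongr
      _ ≤ τ := hL
  -- finite subfamily
  set U : Set X := ⋃ p ∈ C, bowenBall (F p.2) p.1 ε with hU
  have hμU : μ U = 1 := by
    have h1 : μ Uᶜ = 0 := measure_mono_null (compl_subset_compl.2 hCZ) hZ
    have hUm : MeasurableSet U :=
      MeasurableSet.biUnion hCc fun p _ => (bowenBall_isOpen _ _ _).measurableSet
    rwa [prob_compl_eq_zero_iff hUm] at h1
  have hCne : C.Nonempty := by
    by_contra hcon
    rw [not_nonempty_iff_eq_empty] at hcon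
    rw [hU, hcon] at hμU
    simp at hμU
  obtain ⟨f, hf⟩ := hCc.exists_eq_range hCne
  set V : ℕ → Set X := fun n => ⋃ i ∈ Finset.range n, bowenBall (F (f i).2) (f i).1 ε with hV
  have hVU : ⋃ n, V n = U := by
    rw [hU, hf]
    ext x
    simp only [hV, mem_iUnion, Finset.mem_range, mem_range, exists_prop]
    constructor
    · rintro ⟨n, i, _, hi⟩
      exact ⟨f i, ⟨i, rfl⟩, hi⟩
    · rintro ⟨_, ⟨i, rfl⟩, hi⟩
      exact ⟨i + 1, i, Nat.lt_succ_self i, hi⟩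
  have hmono : Monotone V := by
    intro a b hab x hx
    simp only [hV, mem_iUnion, Finset.mem_range, exists_prop] at hx ⊢
    obtain ⟨i, hi, hx⟩ := hx
    exact ⟨i, hi.trans_le hab, hx⟩
  have htend := tendsto_measure_iUnion_atTop (μ := μ) hmono
  rw [hVU, hμU] at htend
  have hVm : ∀ n, MeasurableSet (V n) := fun n =>
    Finset.measurableSet_biUnion _ fun i _ => (bowenBall_isOpen _ _ _).measurableSet
  have hev : ∀ᶠ n in atTop, 1 - ENNReal.ofReal δ < μ (V n) :=
    htend.eventually (lt_mem_nhds (ENNReal.sub_lt_self ENNReal.one_ne_top one_ne_zero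
      (by simpa using hδ)))
  obtain ⟨n, hn⟩ := hev.exists
  refine ⟨(Finset.range n).image f, ?_, hsumfin _ ?_, ?_⟩
  · intro p hp
    obtain ⟨i, _, rfl⟩ := Finset.mem_image.1 hp
    exact (le_max_left _ _).trans (hCN (f i) (hf ▸ mem_range_self i))
  · intro p hp
    obtain ⟨i, _, rfl⟩ := Finset.mem_image.1 (Finset.mem_coe.1 hp)
    exact hf ▸ mem_range_self i
  · have h1 : ⋃ p ∈ (Finset.range n).image f, bowenBall (F p.2) p.1 ε = V n := by
      rw [Finset.set_biUnion_finset_image]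
    rw [h1, prob_compl_eq_one_sub (hVm n)]
    rw [tsub_le_iff_right]
    rw [add_comm, ← tsub_le_iff_right]
    exact hn.le

lemma measEntropy_le_bowenEntropy (F : ℕ → Finset G) (hFol : IsFolnerSeq F)
    (hTemp : IsTemperedSeq F)
    (hGrow : GrowthCond F) (μ : Measure X) [IsProbabilityMeasure μ] (hinv : InvariantMeasure G μ)
    (Z : Set X) (hZ : μ Zᶜ = 0) : measEntropy F μ ≤ bowenEntropy F Z := by
  unfold measEntropy
  refine iSup_le fun k => iSup_le fun α => iSup_le fun hα => ?_
  by_cases hb : bowenEntropy F Z = ⊤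
  · rw [hb]; exact le_top
  set b := (bowenEntropy F Z).toReal with hbdef
  have hb0 : 0 ≤ b := ENNReal.toReal_nonneg
  have hbe : bowenEntropy F Z = ENNReal.ofReal b := (ENNReal.ofReal_toReal hb).symm
  refine ENNReal.le_of_forall_pos_le_add fun η hη _ => ?_
  have hη' : (0 : ℝ) < η := hη
  have hfin : bowenMeasure F Z (b + η / 3) ≠ ⊤ := by
    intro hcon
    have h1 : ENNReal.ofReal (b + η / 3) ≤ bowenEntropy F Z :=
      le_iSup₂ (f := fun (s : ℝ) (_ : bowenMeasure F Z s = ⊤) => ENNReal.ofReal s) _ hcon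
    rw [hbe, ENNReal.ofReal_le_ofReal_iff hb0] at h1
    linarith
  have hcov := cover_of_finite F hGrow μ Z hZ (b + η / 3) (b + 2 * η / 3) (by linarith) hfin
  have hev := entropy_le_of_covers F hFol hTemp hGrow μ hinv (b + 2 * η / 3) (by positivity) hcov
    α hα (η / 3) (by positivity)
  refine limsup_le_of_le (by isBoundedDefault) ?_
  filter_upwards [hev] with n hn
  have hpos : (0 : ℝ) < (F n).card := by exact_mod_cast (hFol.1 n).card_pos
  rw [hbe]
  have h3 : (η : ℝ≥0∞) = ENNReal.ofReal (η : ℝ) := by simp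
  rw [h3, ← ENNReal.ofReal_add hb0 hη'.le]
  apply ENNReal.ofReal_le_ofReal
  rw [div_le_iff₀ hpos]
  refine hn.trans (le_of_eq ?_)
  ring
end PartB4

set_option linter.unusedSectionVars false
set_option linter.unusedVariables false
open MeasureTheory Filter Set
open scoped Pointwise ENNReal NNReal Topology

section PartA1
variable {G : Type*} [Group G] [DecidableEq G]

lemma card_tile_containing (K A : Finset G) (h : G) :
    (A.filter (fun c => h ∈ tile K c)).card ≤ K.card := by
  refine Finset.card_le_card_of_injOn (fun c => h * c⁻¹) ?_ ?_
  · intro c hc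
    have := (Finset.mem_filter.1 hc).2
    exact mem_tile.1 this
  · intro a _ b _ hab
    simpa using hab

lemma frac_cover_aux (F : ℕ → Finset G) (hne : ∀ n, (F n).Nonempty) (A : Finset G) (j : G → ℕ)
    (N : ℕ) (hj : ∀ c ∈ A, j c < N) (k : ℕ) : ∀ m, m + k = N →
    ∃ w : G → ℝ, (∀ c, 0 ≤ w c) ∧ (∀ c ∈ A, j c < m → w c = 0) ∧
      (∀ h, ∑ c ∈ A.filter (fun c => h ∈ tile (F (j c)) c), w c ≤ 2) ∧
      (∀ c ∈ A, m ≤ j c → w c = 1 / (F (j c)).card ∨ ∃ h ∈ tile (F (j c)) c,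
        1 ≤ ∑ c' ∈ A.filter (fun c' => h ∈ tile (F (j c')) c' ∧ j c < j c'), w c') := by
  induction k with
  | zero =>
    intro m hm
    refine ⟨fun _ => 0, fun _ => le_rfl, fun _ _ _ => rfl, fun h => by simp, fun c hc h => ?_⟩
    have := hj c hc
    omega
  | succ k ih =>
    intro m hm
    obtain ⟨w, hw0, hws, hw2, hwr⟩ := ih (m + 1) (by omega)
    have hFm : (0 : ℝ) < (F m).card := by exact_mod_cast (hne m).card_pos
    set Φ : G → ℝ := fun h => ∑ c ∈ A.filter (fun c => h ∈ tile (F (j c)) c), w c with hΦ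
    classical
    set sel : G → Prop := fun c => j c = m ∧ ∀ h ∈ tile (F m) c, Φ h < 1 with hsel
    set w' : G → ℝ := fun c => if sel c then 1 / (F m).card else w c with hw'
    have hw'eq : ∀ c, m < j c → w' c = w c := by
      intro c hc
      simp only [hw', hsel]
      rw [if_neg]
      rintro ⟨h1, _⟩
      omega
    refine ⟨w', ?_, ?_, ?_, ?_⟩
    · intro c
      simp only [hw']
      split_ifs
      · positivity
      · exact hw0 c
    · intro c hc hcm
      simp only [hw']
      rw [if_neg, hws c hc (by omega)]
      rintro ⟨h1, _⟩
      omega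
    · intro h
      by_cases hex : ∃ c ∈ A, sel c ∧ h ∈ tile (F m) c
      · obtain ⟨c₀, hc₀, hs, hh⟩ := hex
        have h1 : Φ h < 1 := hs.2 h hh
        have h2 : ∑ c ∈ A.filter (fun c => h ∈ tile (F (j c)) c), w' c ≤
            ∑ c ∈ A.filter (fun c => h ∈ tile (F (j c)) c),
              (w c + if j c = m then 1 / ((F m).card : ℝ) else 0) := by
          refine Finset.sum_le_sum fun c _ => ?_
          simp only [hw']
          split_ifs with h3 h4 h4
          · linarith [hw0 c]
          · exact absurd h3.1 h4
          · have : (0 : ℝ) ≤ 1 / (F m).card := by positivity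
            linarith
          · linarith
        rw [Finset.sum_add_distrib] at h2
        have h3 : ∑ c ∈ A.filter (fun c => h ∈ tile (F (j c)) c),
            (if j c = m then 1 / ((F m).card : ℝ) else 0) ≤ 1 := by
          rw [← Finset.sum_filter, Finset.sum_const, nsmul_eq_mul, mul_one_div,
            div_le_one hFm]
          have h4 := card_tile_containing (F m) A h
          refine le_trans (Nat.cast_le.2 (Finset.card_le_card ?_)) (Nat.cast_le.2 h4)
          intro c hc
          simp only [Finset.mem_filter] at hc ⊢
          exact ⟨hc.1.1, hc.2 ▸ hc.1.2⟩
        linarith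
      · push Not at hex
        have h1 : ∑ c ∈ A.filter (fun c => h ∈ tile (F (j c)) c), w' c = Φ h := by
          refine Finset.sum_congr rfl fun c hc => ?_
          rw [Finset.mem_filter] at hc
          simp only [hw']
          rw [if_neg]
          intro hs
          exact hex c hc.1 hs (hs.1 ▸ hc.2)
        rw [h1]
        exact hw2 h
    · intro c hc hmc
      rcases hmc.eq_or_lt with heq | hlt
      · by_cases hs : sel c
        · left
          simp only [hw']
          rw [if_pos hs, heq]
        · right
          have : ∃ h ∈ tile (F m) c, 1 ≤ Φ h := by
            by_contra hcon
            push Not at hcon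
            exact hs ⟨heq.symm, hcon⟩
          obtain ⟨h, hh, h1⟩ := this
          refine ⟨h, heq ▸ hh, h1.trans (le_of_eq ?_)⟩
          rw [← heq]
          simp only [hΦ]
          symm
          rw [← Finset.filter_filter, Finset.sum_filter]
          refine Finset.sum_congr rfl fun c' hc' => ?_
          split_ifs with h5
          · exact hw'eq c' h5
          · exact (hws c' (Finset.mem_filter.1 hc').1 (by omega)).symm
      · rcases hwr c hc hlt with h1 | ⟨h, hh, h1⟩
        · left
          rw [hw'eq c hlt, h1]
        · right
          refine ⟨h, hh, h1.trans (le_of_eq ?_)⟩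
          refine Finset.sum_congr rfl fun c' hc' => ?_
          rw [hw'eq c' (hlt.trans (Finset.mem_filter.1 hc').2.2)]

lemma frac_cover (F : ℕ → Finset G) (hne : ∀ n, (F n).Nonempty) (C : ℝ) (hC0 : 0 ≤ C)
    (hC : ∀ n : ℕ, (((Finset.range n).biUnion fun k => (F k)⁻¹ * F n).card : ℝ)
      ≤ C * (F n).card) (A : Finset G) (j : G → ℕ)
    (N : ℕ) (hj : ∀ c ∈ A, j c < N) :
    ∃ w : G → ℝ, (∀ c, 0 ≤ w c) ∧
      (∀ h, ∑ c ∈ A.filter (fun c => h ∈ tile (F (j c)) c), w c ≤ 2) ∧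
      (A.card : ℝ) ≤ (1 + C) * ∑ c ∈ A, w c * (F (j c)).card := by
  classical
  obtain ⟨w, hw0, _, hw2, hwr⟩ := frac_cover_aux F hne A j N hj N 0 (by omega)
  refine ⟨w, hw0, hw2, ?_⟩
  set A₁ := A.filter (fun c => w c = 1 / (F (j c)).card) with hA₁
  set A₂ := A.filter (fun c => ¬ w c = 1 / (F (j c)).card) with hA₂
  have hFc : ∀ n, (0 : ℝ) < (F n).card := fun n => by exact_mod_cast (hne n).card_pos
  have h1 : (A₁.card : ℝ) ≤ ∑ c ∈ A, w c * (F (j c)).card := by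
    calc (A₁.card : ℝ) = ∑ c ∈ A₁, w c * (F (j c)).card := by
          rw [Finset.card_eq_sum_ones, Nat.cast_sum]
          refine Finset.sum_congr rfl fun c hc => ?_
          rw [(Finset.mem_filter.1 hc).2]
          have := (hFc (j c)).ne'
          field_simp
          simp
      _ ≤ _ := Finset.sum_le_sum_of_subset_of_nonneg (Finset.filter_subset _ _)
          fun c _ _ => mul_nonneg (hw0 c) (hFc _).le
  set B : G → Finset G := fun c' =>
    tile ((Finset.range (j c')).biUnion fun k => (F k)⁻¹ * F (j c')) c' with hB
  have h2 : (A₂.card : ℝ) ≤ C * ∑ c ∈ A, w c * (F (j c)).card := by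
    calc (A₂.card : ℝ) = ∑ c ∈ A₂, (1 : ℝ) := by simp
      _ ≤ ∑ c ∈ A₂, ∑ c' ∈ A, (if c ∈ B c' then w c' else 0) := by
          refine Finset.sum_le_sum fun c hc => ?_
          obtain ⟨hcA, hc2⟩ := Finset.mem_filter.1 hc
          obtain ⟨h, hh, h3⟩ := (hwr c hcA (Nat.zero_le _)).resolve_left hc2
          refine h3.trans ?_
          rw [← Finset.sum_filter]
          refine Finset.sum_le_sum_of_subset_of_nonneg ?_ fun c _ _ => hw0 c
          intro c' hc'
          obtain ⟨h4, h5, h6⟩ := Finset.mem_filter.1 hc'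
          refine Finset.mem_filter.2 ⟨h4, ?_⟩
          simp only [hB]
          rw [mem_tile, Finset.mem_biUnion]
          refine ⟨j c, Finset.mem_range.2 h6, ?_⟩
          have h7 : c * c'⁻¹ = (h * c⁻¹)⁻¹ * (h * c'⁻¹) := by group
          rw [h7]
          exact Finset.mul_mem_mul (Finset.inv_mem_inv (mem_tile.1 hh)) (mem_tile.1 h5)
      _ = ∑ c' ∈ A, ∑ c ∈ A₂, (if c ∈ B c' then w c' else 0) := Finset.sum_comm
      _ ≤ ∑ c' ∈ A, w c' * (C * (F (j c')).card) := by
          refine Finset.sum_le_sum fun c' _ => ?_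
          rw [← Finset.sum_filter, Finset.sum_const, nsmul_eq_mul, mul_comm]
          refine mul_le_mul_of_nonneg_left ?_ (hw0 c')
          refine le_trans ?_ (hC (j c'))
          rw [← card_tile ((Finset.range (j c')).biUnion fun k => (F k)⁻¹ * F (j c')) c']
          refine Nat.cast_le.2 (Finset.card_le_card ?_)
          intro c hc
          exact (Finset.mem_filter.1 hc).2
      _ = _ := by
          rw [Finset.mul_sum]
          exact Finset.sum_congr rfl fun c _ => by ring
  have h3 : (A.card : ℝ) = A₁.card + A₂.card := by
    rw [hA₁, hA₂]
    exact_mod_cast (Finset.card_filter_add_card_filter_not (s := A) (fun c => w c = 1 / (F (j c)).card)).symm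
  rw [h3]
  linarith
end PartA1

set_option linter.unusedSectionVars false
set_option linter.unusedVariables false
open MeasureTheory Filter Set
open scoped Pointwise ENNReal NNReal Topology

section PartA2
variable {G : Type*} [Group G] [DecidableEq G]
  {X : Type*} [MetricSpace X] [CompactSpace X] [MulAction G X] [ContinuousConstSMul G X]
  [MeasurableSpace X] [BorelSpace X]

open Classical in
lemma orbit_maximal (F : ℕ → Finset G) (hne : ∀ n, (F n).Nonempty) (C : ℝ) (hC0 : 0 ≤ C)
    (hC : ∀ n : ℕ, (((Finset.range n).biUnion fun k => (F k)⁻¹ * F n).card : ℝ)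
      ≤ C * (F n).card) (N m : ℕ) (f : X → ℝ) (hf : ∀ x, 0 ≤ f x) (l : ℝ) (hl : 0 ≤ l) (x : X) :
    l * (((F m).filter
      (fun c => ∃ n < N, l * (F n).card < ∑ g ∈ F n, f (g • (c • x)))).card : ℝ) ≤
    (1 + C) * 2 * ∑ h ∈ F m ∪ (((Finset.range N).biUnion F) * F m) \ F m, f (h • x) := by
  set A := (F m).filter
      (fun c => ∃ n < N, l * (F n).card < ∑ g ∈ F n, f (g • (c • x))) with hA
  set E := F m ∪ (((Finset.range N).biUnion F) * F m) \ F m with hE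
  have hj : ∀ c : G, ∃ n, c ∈ A → n < N ∧ l * (F n).card < ∑ g ∈ F n, f (g • (c • x)) := by
    intro c
    by_cases hc : c ∈ A
    · obtain ⟨n, h1, h2⟩ := (Finset.mem_filter.1 hc).2
      exact ⟨n, fun _ => ⟨h1, h2⟩⟩
    · exact ⟨0, fun h => absurd h hc⟩
  choose j hj using hj
  obtain ⟨w, hw0, hw2, hwA⟩ := frac_cover F hne C hC0 hC A j N (fun c hc => (hj c hc).1)
  have hsum : ∀ c, ∑ g ∈ F (j c), f (g • (c • x)) = ∑ h ∈ tile (F (j c)) c, f (h • x) := by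
    intro c
    unfold tile
    rw [Finset.sum_image (fun a _ b _ hab => mul_right_cancel hab)]
    exact Finset.sum_congr rfl fun g _ => by rw [smul_smul]
  have hsub : ∀ c ∈ A, tile (F (j c)) c ⊆ E := by
    intro c hc h hh
    have hcm : c ∈ F m := (Finset.mem_filter.1 hc).1
    rw [hE, Finset.union_sdiff_self_eq_union]
    refine Finset.mem_union_right _ ?_
    have : h = h * c⁻¹ * c := by group
    rw [this]
    exact Finset.mul_mem_mul (Finset.mem_biUnion.2
      ⟨j c, Finset.mem_range.2 (hj c hc).1, mem_tile.1 hh⟩) hcm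
  calc l * (A.card : ℝ) ≤ l * ((1 + C) * ∑ c ∈ A, w c * (F (j c)).card) := by gcongr
    _ = (1 + C) * ∑ c ∈ A, w c * (l * (F (j c)).card) := by
        rw [Finset.mul_sum, Finset.mul_sum, Finset.mul_sum]
        exact Finset.sum_congr rfl fun c _ => by ring
    _ ≤ (1 + C) * ∑ c ∈ A, w c * ∑ h ∈ tile (F (j c)) c, f (h • x) := by
        gcongr with c hc
        · exact hw0 c
        · rw [← hsum]; exact (hj c hc).2.le
    _ = (1 + C) * ∑ c ∈ A, ∑ h ∈ E, (if h ∈ tile (F (j c)) c then w c * f (h • x) else 0) := by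
        congr 1
        refine Finset.sum_congr rfl fun c hc => ?_
        rw [Finset.mul_sum, ← Finset.sum_filter]
        refine Finset.sum_congr ?_ fun _ _ => rfl
        ext h
        rw [Finset.mem_filter]
        exact ⟨fun hh => ⟨hsub c hc hh, hh⟩, fun hh => hh.2⟩
    _ = (1 + C) * ∑ h ∈ E, (∑ c ∈ A.filter (fun c => h ∈ tile (F (j c)) c), w c) * f (h • x) := by
        rw [Finset.sum_comm]
        congr 1
        refine Finset.sum_congr rfl fun h _ => ?_
        rw [← Finset.sum_filter, Finset.sum_mul]
    _ ≤ (1 + C) * ∑ h ∈ E, 2 * f (h • x) := by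
        gcongr with h hh
        · exact hf _
        · exact hw2 h
    _ = _ := by rw [← Finset.mul_sum]; ring

lemma mp_smul {μ : Measure X} (hinv : InvariantMeasure G μ) (g : G) :
    MeasurePreserving (fun x : X => g • x) μ μ := ⟨measurable_smulX g, hinv g⟩

open Classical in
lemma maximal_ineq_N (F : ℕ → Finset G) (hFol : IsFolnerSeq F) (C : ℝ) (hC0 : 0 ≤ C)
    (hC : ∀ n : ℕ, (((Finset.range n).biUnion fun k => (F k)⁻¹ * F n).card : ℝ)
      ≤ C * (F n).card) {μ : Measure X} [IsProbabilityMeasure μ] (hinv : InvariantMeasure G μ)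
    (N : ℕ) (f : C(X, ℝ)) (hf : ∀ x, 0 ≤ f x) (l : ℝ) (hl : 0 ≤ l) :
    l * μ.real {x | ∃ n < N, l * (F n).card < ∑ g ∈ F n, f (g • x)} ≤
      (1 + C) * 4 * ∫ x, f x ∂μ := by
  set B : Set X := {x | ∃ n < N, l * (F n).card < ∑ g ∈ F n, f (g • x)} with hB
  have hBm : MeasurableSet B := by
    have : B = ⋃ n ∈ Finset.range N, {x | l * (F n).card < ∑ g ∈ F n, f (g • x)} := by
      ext x
      simp [hB]
    rw [this]
    refine Finset.measurableSet_biUnion _ fun n _ => ?_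
    refine (isOpen_lt continuous_const ?_).measurableSet
    exact continuous_finset_sum _ fun g _ => f.continuous.comp (continuous_const_smul g)
  obtain ⟨m, hm⟩ := (folner_mul_sdiff hFol ((Finset.range N).biUnion F) one_pos).exists
  have hFm : (0 : ℝ) < (F m).card := by exact_mod_cast (hFol.1 m).card_pos
  set E := F m ∪ (((Finset.range N).biUnion F) * F m) \ F m with hE
  have hEc : (E.card : ℝ) ≤ 2 * (F m).card := by
    have := Finset.card_union_le (F m) ((((Finset.range N).biUnion F) * F m) \ F m)
    have h2 : (E.card : ℝ) ≤ (F m).card + ((((Finset.range N).biUnion F) * F m) \ F m).card := by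
      exact_mod_cast this
    linarith
  have hfi : Integrable f μ := f.continuous.integrable_of_hasCompactSupport
    (HasCompactSupport.of_compactSpace f)
  have hfg : ∀ g : G, Integrable (fun x => f (g • x)) μ := fun g =>
    (mp_smul hinv g).integrable_comp_of_integrable hfi
  have hfint : ∀ g : G, ∫ x, f (g • x) ∂μ = ∫ x, f x ∂μ := fun g => by
    have h := integral_map (μ := μ) (measurable_smulX (X := X) g).aemeasurable
      (f := f) (by rw [hinv g]; exact hfi.aestronglyMeasurable)
    rw [hinv g] at h
    exact h.symm
  have hBg : ∀ c : G, MeasurableSet ((fun x : X => c • x) ⁻¹' B) := fun c =>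
    measurable_smulX c hBm
  have hint1 : ∫ x, l * (((F m).filter (fun c => c • x ∈ B)).card : ℝ) ∂μ =
      l * ((F m).card * μ.real B) := by
    rw [integral_const_mul]
    congr 1
    have h1 : ∀ x, (((F m).filter (fun c => c • x ∈ B)).card : ℝ) =
        ∑ c ∈ F m, ((fun x : X => c • x) ⁻¹' B).indicator (fun _ => (1 : ℝ)) x := by
      intro x
      rw [Finset.card_filter, Nat.cast_sum]
      refine Finset.sum_congr rfl fun c _ => ?_
      simp [indicator_apply]
    simp_rw [h1]
    rw [integral_finset_sum]
    · have : ∀ c ∈ F m, ∫ x, ((fun x : X => c • x) ⁻¹' B).indicator (fun _ => (1 : ℝ)) x ∂μ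
          = μ.real B := by
        intro c _
        rw [integral_indicator_const _ (hBg c)]
        simp [Measure.real, measure_preimage_smulX hinv c hBm]
      rw [Finset.sum_congr rfl this]
      simp
    · intro c _
      exact (integrable_const _).indicator (hBg c)
  have hint2 : ∫ x, (1 + C) * 2 * ∑ h ∈ E, f (h • x) ∂μ =
      (1 + C) * 2 * (E.card * ∫ x, f x ∂μ) := by
    rw [integral_const_mul, integral_finset_sum _ fun g _ => hfg g]
    simp [hfint]
  have hle : ∫ x, l * (((F m).filter (fun c => c • x ∈ B)).card : ℝ) ∂μ ≤
      ∫ x, (1 + C) * 2 * ∑ h ∈ E, f (h • x) ∂μ := by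
    refine integral_mono_of_nonneg (ae_of_all _ fun x => by positivity) ?_ (ae_of_all _ fun x => ?_)
    · exact (integrable_finset_sum _ fun g _ => hfg g).const_mul _
    · exact orbit_maximal F hFol.1 C hC0 hC N m f hf l hl x
  rw [hint1, hint2] at hle
  have hf0 : 0 ≤ ∫ x, f x ∂μ := integral_nonneg hf
  have h3 : l * ((F m).card * μ.real B) ≤ (1 + C) * 2 * (2 * (F m).card * ∫ x, f x ∂μ) :=
    hle.trans (by gcongr)
  have h4 : (F m).card * (l * μ.real B) ≤ (F m).card * ((1 + C) * 4 * ∫ x, f x ∂μ) := by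
    linarith
  exact le_of_mul_le_mul_left h4 hFm

lemma maximal_ineq (F : ℕ → Finset G) (hFol : IsFolnerSeq F) (C : ℝ) (hC0 : 0 ≤ C)
    (hC : ∀ n : ℕ, (((Finset.range n).biUnion fun k => (F k)⁻¹ * F n).card : ℝ)
      ≤ C * (F n).card) {μ : Measure X} [IsProbabilityMeasure μ] (hinv : InvariantMeasure G μ)
    (f : C(X, ℝ)) (hf : ∀ x, 0 ≤ f x) (l : ℝ) (hl : 0 < l) :
    μ {x | ∃ n, l * (F n).card < ∑ g ∈ F n, f (g • x)} ≤
      ENNReal.ofReal ((1 + C) * 4 * (∫ x, f x ∂μ) / l) := by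
  have h1 : {x | ∃ n, l * (F n).card < ∑ g ∈ F n, f (g • x)} =
      ⋃ N : ℕ, {x | ∃ n < N, l * (F n).card < ∑ g ∈ F n, f (g • x)} := by
    ext x
    simp only [mem_setOf_eq, mem_iUnion]
    constructor
    · rintro ⟨n, hn⟩
      exact ⟨n + 1, n, Nat.lt_succ_self n, hn⟩
    · rintro ⟨N, n, _, hn⟩
      exact ⟨n, hn⟩
  have hmono : Monotone fun N : ℕ => {x : X | ∃ n < N, l * (F n).card < ∑ g ∈ F n, f (g • x)} := by
    intro a b hab x hx
    obtain ⟨n, hn, hx⟩ := hx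
    exact ⟨n, hn.trans_le hab, hx⟩
  rw [h1, hmono.measure_iUnion]
  refine iSup_le fun N => ?_
  have h2 := maximal_ineq_N F hFol C hC0 hC hinv N f hf l hl.le
  rw [← ENNReal.ofReal_toReal (measure_ne_top μ _)]
  apply ENNReal.ofReal_le_ofReal
  rw [le_div_iff₀ hl, mul_comm]
  exact h2
end PartA2

set_option linter.unusedSectionVars false
set_option linter.unusedVariables false
open MeasureTheory Filter Set
open scoped Pointwise ENNReal NNReal Topology

section PartA3
variable {G : Type*} [Group G] [DecidableEq G]
  {X : Type*} [MetricSpace X] [CompactSpace X] [MulAction G X] [ContinuousConstSMul G X]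
  [MeasurableSpace X] [BorelSpace X]

/-- Composition of a continuous function with the action of a group element. -/
def compSmul (φ : C(X, ℝ)) (g : G) : C(X, ℝ) := ⟨fun x => φ (g • x),
  φ.continuous.comp (continuous_const_smul g)⟩

lemma cobdry_tendsto (F : ℕ → Finset G) (hFol : IsFolnerSeq F) (φ : C(X, ℝ)) (g : G) (x : X) :
    Tendsto (fun n => (∑ h ∈ F n, (compSmul φ g - φ) (h • x)) / (F n).card) atTop (𝓝 0) := by
  have h1 := (hFol.2 g).const_mul ‖φ‖
  rw [mul_zero] at h1
  refine squeeze_zero_norm (fun n => ?_) h1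
  have hpos : (0 : ℝ) < (F n).card := by exact_mod_cast (hFol.1 n).card_pos
  rw [norm_div, Real.norm_natCast, ← mul_div_assoc]
  gcongr
  have h2 : ∑ h ∈ F n, (compSmul φ g - φ) (h • x) =
      ∑ h ∈ (F n).image (g * ·), φ (h • x) - ∑ h ∈ F n, φ (h • x) := by
    rw [Finset.sum_image (fun a _ b _ hab => mul_left_cancel hab), ← Finset.sum_sub_distrib]
    refine Finset.sum_congr rfl fun h _ => ?_
    simp [compSmul, smul_smul]
  rw [h2, ← Finset.sum_sdiff_sub_sum_sdiff]
  have h3 : ∀ T : Finset G, ‖∑ h ∈ T, φ (h • x)‖ ≤ ‖φ‖ * T.card := by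
    intro T
    refine (norm_sum_le _ _).trans ?_
    refine (Finset.sum_le_card_nsmul _ _ ‖φ‖ fun h _ => φ.norm_coe_le_norm _).trans (le_of_eq ?_)
    rw [nsmul_eq_mul, mul_comm]
  refine (norm_sub_le _ _).trans ((add_le_add (h3 _) (h3 _)).trans (le_of_eq ?_))
  rw [← mul_add]
  congr 1
  have h4 : (symmDiff (F n) ((F n).image (g * ·))).card =
      ((F n) \ (F n).image (g * ·)).card + ((F n).image (g * ·) \ F n).card := by
    rw [symmDiff_def, Finset.sup_eq_union, Finset.card_union_of_disjoint]
    exact disjoint_sdiff_sdiff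
  rw [h4, add_comm]
  push_cast
  ring

/-- Continuous functions whose ergodic averages vanish pointwise. -/
def nullAvg (F : ℕ → Finset G) (X : Type*) [MetricSpace X] [MulAction G X] :
    Submodule ℝ C(X, ℝ) where
  carrier := {p | ∀ x, Tendsto (fun n => (∑ h ∈ F n, p (h • x)) / (F n).card) atTop (𝓝 0)}
  zero_mem' := fun x => by simp
  add_mem' := fun {p q} hp hq x => by
    have := (hp x).add (hq x)
    rw [add_zero] at this
    refine this.congr fun n => ?_
    simp only [ContinuousMap.add_apply, Finset.sum_add_distrib, add_div]
  smul_mem' := fun c p hp x => by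
    have := (hp x).const_mul c
    rw [mul_zero] at this
    refine this.congr fun n => ?_
    simp only [ContinuousMap.smul_apply, smul_eq_mul, ← Finset.mul_sum, mul_div_assoc]

lemma invariant_ae_const {μ : Measure X} [IsProbabilityMeasure μ] (herg : ErgodicMeasure G μ)
    (u : X → ℝ) (hu : Measurable u) (huinv : ∀ g : G, ∀ᵐ x ∂μ, u (g • x) = u x) :
    ∃ c : ℝ, u =ᵐ[μ] fun _ => c := by
  obtain ⟨c, hc⟩ := Filter.exists_eventuallyEq_const_of_forall_separating (l := ae μ) (f := u)
    MeasurableSet (by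
      intro U hU
      have hA : MeasurableSet (u ⁻¹' U) := hu hU
      rcases herg (u ⁻¹' U) hA (by
        intro g
        rw [measure_symmDiff_eq_zero_iff]
        filter_upwards [huinv g] with x hx
        change (u x ∈ U) = (u (g • x) ∈ U)
        rw [hx]) with h | h
      · right
        exact measure_eq_zero_iff_ae_notMem.1 h
      · left
        exact (mem_ae_iff_prob_eq_one hA).2 h)
  exact ⟨c, hc⟩

lemma nullAvg_dense (F : ℕ → Finset G) (hFol : IsFolnerSeq F) {μ : Measure X}
    [IsProbabilityMeasure μ] (hinv : InvariantMeasure G μ) (herg : ErgodicMeasure G μ)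
    (f : C(X, ℝ)) (hf : ∫ x, f x ∂μ = 0) (η : ℝ) (hη : 0 < η) :
    ∃ p ∈ nullAvg F X, ∫ x, |(f - p) x| ∂μ ≤ η := by
  set T : C(X, ℝ) →L[ℝ] Lp ℝ 2 μ := ContinuousMap.toLp 2 μ ℝ with hT
  set M : Submodule ℝ (Lp ℝ 2 μ) := (nullAvg F X).map (T : C(X, ℝ) →ₗ[ℝ] Lp ℝ 2 μ) with hM
  have hmem : T f ∈ M.topologicalClosure := by
    rw [← Submodule.orthogonal_orthogonal_eq_closure, Submodule.mem_orthogonal]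
    intro u hu
    rw [Submodule.mem_orthogonal] at hu
    -- invariance
    have hUinv : ∀ g : G, Lp.compMeasurePreservingₗᵢ ℝ (fun x : X => g • x) (mp_smul hinv g) u
        = u := by
      intro g
      set U := Lp.compMeasurePreservingₗᵢ (E := ℝ) (p := 2) ℝ (fun x : X => g • x)
        (mp_smul hinv g) with hU
      have hTU : ∀ φ : C(X, ℝ), U (T φ) = T (compSmul φ g) := by
        intro φ
        apply Lp.ext
        have h1 : (U (T φ) : X → ℝ) =ᵐ[μ] (T φ : X → ℝ) ∘ (fun x => g • x) :=
          Lp.coeFn_compMeasurePreserving (T φ) (mp_smul hinv g)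
        have h2 : (T φ : X → ℝ) ∘ (fun x : X => g • x) =ᵐ[μ] φ ∘ (fun x => g • x) :=
          (mp_smul hinv g).quasiMeasurePreserving.ae_eq_comp
            (ContinuousMap.coeFn_toLp (p := 2) (𝕜 := ℝ) μ φ)
        have h3 := ContinuousMap.coeFn_toLp (p := 2) (𝕜 := ℝ) μ (compSmul φ g)
        exact (h1.trans h2).trans h3.symm
      have hφ : ∀ φ : C(X, ℝ), inner ℝ (U (T φ)) u = inner ℝ (T φ) u := by
        intro φ
        have h1 := hu (T (compSmul φ g - φ)) ⟨compSmul φ g - φ, fun x =>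
          cobdry_tendsto F hFol φ g x, rfl⟩
        rw [map_sub, inner_sub_left, ← hTU] at h1
        linarith
      have hall : ∀ v, inner ℝ (U v) u = inner ℝ v u := by
        have hd : DenseRange T := ContinuousMap.toLp_denseRange ℝ μ ℝ (by norm_num)
        intro v
        refine hd.induction_on (p := fun v => inner ℝ (U v) u = inner ℝ v u) v ?_ hφ
        refine isClosed_eq ?_ ?_
        · exact (U.continuous).inner continuous_const
        · exact continuous_id.inner continuous_const
      have h0 : ‖U u - u‖ ^ 2 = 0 := by
        rw [norm_sub_sq_real, hall u, real_inner_self_eq_norm_sq, U.norm_map]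
        ring
      have h1 : ‖U u - u‖ = 0 := by simpa using h0
      exact sub_eq_zero.1 (norm_eq_zero.1 h1)
    obtain ⟨c, hc⟩ := invariant_ae_const (G := G) herg (u : X → ℝ)
      (Lp.stronglyMeasurable u).measurable (by
        intro g
        have h1 : (Lp.compMeasurePreservingₗᵢ ℝ (fun x : X => g • x) (mp_smul hinv g) u : X → ℝ)
          =ᵐ[μ] (u : X → ℝ) ∘ (fun x => g • x) :=
          Lp.coeFn_compMeasurePreserving u (mp_smul hinv g)
        rw [hUinv g] at h1
        filter_upwards [h1] with x hx
        exact hx.symm)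
    rw [L2.inner_def]
    have h5 : ∫ a, inner ℝ (u a) ((T f : X → ℝ) a) ∂μ = ∫ a, f a * c ∂μ := by
      refine integral_congr_ae ?_
      filter_upwards [hc, ContinuousMap.coeFn_toLp (p := 2) (𝕜 := ℝ) μ f] with a h1 h2
      rw [h1, h2]
      simp
    rw [h5, integral_mul_const, hf, zero_mul]
  have hmem' : T f ∈ closure (M : Set (Lp ℝ 2 μ)) := hmem
  obtain ⟨_, ⟨p, hp, rfl⟩, hdist⟩ := Metric.mem_closure_iff.1 hmem' η hη
  refine ⟨p, hp, ?_⟩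
  change dist (T f) (T p) < η at hdist
  rw [dist_eq_norm, ← map_sub, Lp.norm_def] at hdist
  have h6 : eLpNorm (T (f - p) : X → ℝ) 2 μ = eLpNorm (f - p : C(X, ℝ)) 2 μ :=
    eLpNorm_congr_ae (ContinuousMap.coeFn_toLp (p := 2) (𝕜 := ℝ) μ (f - p))
  have hms : AEStronglyMeasurable (f - p : C(X, ℝ)) μ :=
    (f - p).continuous.aestronglyMeasurable
  have h7 : ∫ x, |(f - p) x| ∂μ = (eLpNorm (f - p : C(X, ℝ)) 1 μ).toReal := by
    rw [eLpNorm_one_eq_lintegral_enorm]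
    exact integral_norm_eq_lintegral_enorm hms
  rw [h7]
  refine le_trans (ENNReal.toReal_mono ?_ (eLpNorm_le_eLpNorm_of_exponent_le
    (by norm_num : (1 : ℝ≥0∞) ≤ 2) hms)) ?_
  · rw [← h6]
    exact Lp.eLpNorm_ne_top _
  · rw [← h6]
    exact hdist.le
end PartA3

set_option linter.unusedSectionVars false
set_option linter.unusedVariables false
open MeasureTheory Filter Set
open scoped Pointwise ENNReal NNReal Topology

section PartA4
variable {G : Type*} [Group G] [DecidableEq G]
  {X : Type*} [MetricSpace X] [CompactSpace X] [MulAction G X] [ContinuousConstSMul G X]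
  [MeasurableSpace X] [BorelSpace X]

lemma ae_small (F : ℕ → Finset G) (hFol : IsFolnerSeq F) (hTemp : IsTemperedSeq F) {μ : Measure X}
    [IsProbabilityMeasure μ] (hinv : InvariantMeasure G μ) (herg : ErgodicMeasure G μ)
    (f : C(X, ℝ)) (hf : ∫ x, f x ∂μ = 0) (l : ℝ) (hl : 0 < l) :
    ∀ᵐ x ∂μ, ∀ᶠ n in atTop, |(∑ g ∈ F n, f (g • x)) / (F n).card| ≤ 2 * l := by
  obtain ⟨C', hC'⟩ := hTemp
  set C := max C' 0 with hCdef
  have hC0 : 0 ≤ C := le_max_right _ _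
  have hC : ∀ n : ℕ, (((Finset.range n).biUnion fun k => (F k)⁻¹ * F n).card : ℝ)
      ≤ C * (F n).card := fun n => (hC' n).trans (by gcongr; exact le_max_left _ _)
  rw [ae_iff]
  refine le_antisymm ?_ zero_le
  refine ENNReal.le_of_forall_pos_le_add fun ν hν _ => ?_
  have hν' : (0 : ℝ) < ν := hν
  obtain ⟨p, hp, hpi⟩ := nullAvg_dense F hFol hinv herg f hf (ν * l / ((1 + C) * 4))
    (by positivity)
  set q : C(X, ℝ) := ⟨fun x => |(f - p) x|, (f - p).continuous.abs⟩ with hq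
  have hmax := maximal_ineq F hFol C hC0 hC hinv q (fun x => abs_nonneg _) l hl
  rw [zero_add]
  have hbd : ENNReal.ofReal ((1 + C) * 4 * (∫ x, q x ∂μ) / l) ≤ (ν : ℝ≥0∞) := by
    have h3 : (ν : ℝ≥0∞) = ENNReal.ofReal (ν : ℝ) := by simp
    rw [h3]
    apply ENNReal.ofReal_le_ofReal
    rw [div_le_iff₀ hl]
    have h4 : ∫ x, q x ∂μ ≤ ν * l / ((1 + C) * 4) := hpi
    rw [le_div_iff₀ (by positivity)] at h4
    linarith
  refine le_trans (measure_mono ?_) (hmax.trans hbd)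
  intro x hx
  by_contra hcon
  apply hx
  have hcon' : ∀ n, ∑ g ∈ F n, q (g • x) ≤ l * (F n).card := by
    intro n
    by_contra h
    push Not at h
    exact hcon ⟨n, h⟩
  have hpx := (hp x).abs
  rw [abs_zero] at hpx
  filter_upwards [hpx.eventually (ge_mem_nhds hl)] with n hn
  have hpos : (0 : ℝ) < (F n).card := by exact_mod_cast (hFol.1 n).card_pos
  rw [abs_div, abs_of_pos hpos, div_le_iff₀ hpos] at hn ⊢
  have h1 : |∑ g ∈ F n, f (g • x)| ≤ |∑ g ∈ F n, p (g • x)| + ∑ g ∈ F n, q (g • x) := by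
    have h2 : ∑ g ∈ F n, f (g • x) = ∑ g ∈ F n, p (g • x) + ∑ g ∈ F n, (f - p) (g • x) := by
      rw [← Finset.sum_add_distrib]
      exact Finset.sum_congr rfl fun g _ => by simp
    rw [h2]
    refine (abs_add_le _ _).trans ?_
    gcongr
    exact Finset.abs_sum_le_sum_abs _ _
  have := hcon' n
  linarith

lemma ae_tendsto_avg (F : ℕ → Finset G) (hFol : IsFolnerSeq F) (hTemp : IsTemperedSeq F)
    {μ : Measure X}
    [IsProbabilityMeasure μ] (hinv : InvariantMeasure G μ) (herg : ErgodicMeasure G μ)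
    (f : C(X, ℝ)) :
    ∀ᵐ x ∂μ, Tendsto (fun n => (∑ g ∈ F n, f (g • x)) / (F n).card) atTop (𝓝 (∫ y, f y ∂μ)) := by
  set c := ∫ y, f y ∂μ with hc
  set f₀ : C(X, ℝ) := f - ContinuousMap.const X c with hf₀
  have hfi : Integrable f μ := f.continuous.integrable_of_hasCompactSupport
    (HasCompactSupport.of_compactSpace f)
  have hIntg : ∫ x, f₀ x ∂μ = 0 := by
    have : ∫ x, f₀ x ∂μ = ∫ x, (f x - c) ∂μ := rfl
    rw [this, integral_sub hfi (integrable_const _)]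
    simp [hc]
  have h1 : ∀ᵐ x ∂μ, ∀ k : ℕ, ∀ᶠ n in atTop,
      |(∑ g ∈ F n, f₀ (g • x)) / (F n).card| ≤ 2 * (1 / ((k : ℝ) + 1)) := by
    rw [ae_all_iff]
    exact fun k => ae_small F hFol hTemp hinv herg f₀ hIntg _ (by positivity)
  filter_upwards [h1] with x hx
  rw [Metric.tendsto_atTop']
  intro ε hε
  obtain ⟨k, hk⟩ := exists_nat_one_div_lt (show 0 < ε / 2 by positivity)
  obtain ⟨N, hN⟩ := eventually_atTop.1 (hx k)
  refine ⟨N, fun n hn => ?_⟩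
  have h2 := hN n hn.le
  have hpos : (0 : ℝ) < (F n).card := by exact_mod_cast (hFol.1 n).card_pos
  have h3 : (∑ g ∈ F n, f₀ (g • x)) / (F n).card = (∑ g ∈ F n, f (g • x)) / (F n).card - c := by
    simp only [hf₀, ContinuousMap.sub_apply, ContinuousMap.const_apply, Finset.sum_sub_distrib,
      Finset.sum_const, nsmul_eq_mul]
    field_simp
  rw [h3] at h2
  rw [Real.dist_eq]
  linarith

lemma generic_full (F : ℕ → Finset G) (hFol : IsFolnerSeq F) (hTemp : IsTemperedSeq F)
    (μ : Measure X)
    [IsProbabilityMeasure μ] (hinv : InvariantMeasure G μ) (herg : ErgodicMeasure G μ) :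
    μ (genericPointSet F μ)ᶜ = 0 := by
  have h1 : ∀ᵐ x ∂μ, ∀ k : ℕ, Tendsto (fun n =>
      (∑ g ∈ F n, (TopologicalSpace.denseSeq C(X, ℝ) k) (g • x)) / (F n).card) atTop
      (𝓝 (∫ y, (TopologicalSpace.denseSeq C(X, ℝ) k) y ∂μ)) := by
    rw [ae_all_iff]
    exact fun k => ae_tendsto_avg F hFol hTemp hinv herg _
  change ∀ᵐ x ∂μ, x ∈ genericPointSet F μ
  filter_upwards [h1] with x hx
  intro f
  rw [Metric.tendsto_atTop']
  intro ε hε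
  obtain ⟨k, hk⟩ := (TopologicalSpace.denseRange_denseSeq C(X, ℝ)).exists_dist_lt f
    (show 0 < ε / 3 by positivity)
  set p := TopologicalSpace.denseSeq C(X, ℝ) k with hp
  obtain ⟨N, hN⟩ := (Metric.tendsto_atTop'.1 (hx k)) (ε / 3) (by positivity)
  refine ⟨N, fun n hn => ?_⟩
  have hpos : (0 : ℝ) < (F n).card := by exact_mod_cast (hFol.1 n).card_pos
  have h2 := hN n hn
  have hfp : ∀ y, |f y - p y| ≤ ε / 3 := fun y =>
    le_trans (by rw [← Real.dist_eq]; exact ContinuousMap.dist_apply_le_dist y) hk.le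
  have h3 : |(∑ g ∈ F n, f (g • x)) / (F n).card - (∑ g ∈ F n, p (g • x)) / (F n).card| ≤ ε / 3 := by
    rw [← sub_div, ← Finset.sum_sub_distrib, abs_div, abs_of_pos hpos, div_le_iff₀ hpos]
    refine (Finset.abs_sum_le_sum_abs _ _).trans ?_
    refine (Finset.sum_le_card_nsmul _ _ (ε / 3) fun g _ => hfp _).trans (le_of_eq ?_)
    rw [nsmul_eq_mul, mul_comm]
  have hii : ∀ q : C(X, ℝ), Integrable q μ := fun q =>
    q.continuous.integrable_of_hasCompactSupport (HasCompactSupport.of_compactSpace q)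
  have h4 : |∫ y, p y ∂μ - ∫ y, f y ∂μ| ≤ ε / 3 := by
    rw [← integral_sub (hii p) (hii f)]
    have := norm_integral_le_of_norm_le_const (μ := μ) (f := fun y => p y - f y) (C := ε / 3)
      (ae_of_all _ fun y => by rw [Real.norm_eq_abs, abs_sub_comm]; exact hfp y)
    simpa using this
  rw [Real.dist_eq] at h2 ⊢
  have e : (∑ g ∈ F n, f (g • x)) / (F n).card - ∫ y, f y ∂μ =
    ((∑ g ∈ F n, f (g • x)) / (F n).card - (∑ g ∈ F n, p (g • x)) / (F n).card) +
    ((∑ g ∈ F n, p (g • x)) / (F n).card - ∫ y, p y ∂μ) + (∫ y, p y ∂μ - ∫ y, f y ∂μ) := by ring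
  rw [e]
  refine (abs_add_three _ _ _).trans_lt ?_
  linarith
end PartA4

set_option linter.unusedSectionVars false
set_option linter.unusedVariables false
open MeasureTheory Filter Set
open scoped Pointwise ENNReal NNReal Topology

section PartC1

/-- Abstract Shearer inequality. -/
lemma shearer_abstract {G J : Type*} [DecidableEq G] (h : Finset G → ℝ)
    (hsub : ∀ A B : Finset G, ∀ a, A ⊆ B → h (insert a B) - h B ≤ h (insert a A) - h A)
    (hmono : ∀ A B : Finset G, A ⊆ B → h A ≤ h B) (h0 : h ∅ = 0)
    (I : Finset J) (S : J → Finset G) (d : ℕ) (F : Finset G) :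
    (∀ g ∈ F, d ≤ (I.filter (fun c => g ∈ S c)).card) →
    d * h F ≤ ∑ c ∈ I, h (S c ∩ F) := by
  induction F using Finset.induction_on with
  | empty => intro _; simp [h0]
  | insert a F ha ih =>
    intro hd
    have ih' := ih fun g hg => hd g (Finset.mem_insert_of_mem hg)
    have hda := hd a (Finset.mem_insert_self _ _)
    have hstep : ∀ c ∈ I, h (S c ∩ F) + (if a ∈ S c then h (insert a F) - h F else 0)
        ≤ h (S c ∩ insert a F) := by
      intro c _
      split_ifs with hac
      · rw [Finset.inter_insert_of_mem hac]
        have := hsub (S c ∩ F) F a Finset.inter_subset_right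
        linarith
      · rw [Finset.inter_insert_of_notMem hac]
        linarith
    have hs := Finset.sum_le_sum hstep
    rw [Finset.sum_add_distrib, ← Finset.sum_filter, Finset.sum_const, nsmul_eq_mul] at hs
    have h1 : 0 ≤ h (insert a F) - h F := sub_nonneg.2 (hmono _ _ (Finset.subset_insert _ _))
    have h2 : (d : ℝ) * (h (insert a F) - h F) ≤
        ((I.filter (fun c => a ∈ S c)).card : ℝ) * (h (insert a F) - h F) := by
      gcongr
    linarith

variable {G : Type*} [DecidableEq G] {Ω κ : Type*} [Fintype Ω] [DecidableEq κ]

/-- Number of points with the same name on `E`. -/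
def nameCount (nm : Ω → G → κ) (E : Finset G) (ω : Ω) : ℕ :=
  (Finset.univ.filter (fun ω' => ∀ g ∈ E, nm ω g = nm ω' g)).card

lemma nameCount_pos (nm : Ω → G → κ) (E : Finset G) (ω : Ω) : 0 < nameCount nm E ω :=
  Finset.card_pos.2 ⟨ω, by simp⟩

lemma nameCount_congr (nm : Ω → G → κ) (E : Finset G) {ω ω' : Ω}
    (h : ∀ g ∈ E, nm ω g = nm ω' g) : nameCount nm E ω = nameCount nm E ω' := by
  unfold nameCount
  congr 1
  ext ω''
  simp only [Finset.mem_filter, Finset.mem_univ, true_and]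
  exact ⟨fun h' g hg => (h g hg).symm.trans (h' g hg), fun h' g hg => (h g hg).trans (h' g hg)⟩

lemma nameCount_anti (nm : Ω → G → κ) {A B : Finset G} (hAB : A ⊆ B) (ω : Ω) :
    nameCount nm B ω ≤ nameCount nm A ω := by
  refine Finset.card_le_card ?_
  intro ω' h
  simp only [Finset.mem_filter, Finset.mem_univ, true_and] at h ⊢
  exact fun g hg => h g (hAB hg)

lemma submod_sum (nm : Ω → G → κ) (A B : Finset G) (a : G) (hAB : A ⊆ B) :
    ∑ ω, (nameCount nm (insert a A) ω : ℝ) * nameCount nm B ω /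
      (nameCount nm A ω * nameCount nm (insert a B) ω) ≤ Fintype.card Ω := by
  have hpos : ∀ E ω, (0 : ℝ) < nameCount nm E ω := fun E ω => by
    exact_mod_cast nameCount_pos nm E ω
  -- innermost estimate
  have h1 : ∀ ω' ω'' : Ω, ∑ ω, (if (∀ g ∈ B, nm ω g = nm ω' g) ∧ nm ω a = nm ω'' a then
      1 / (nameCount nm (insert a B) ω : ℝ) else 0) ≤ 1 := by
    intro ω' ω''
    rw [← Finset.sum_filter]
    set T := Finset.univ.filter (fun ω => (∀ g ∈ B, nm ω g = nm ω' g) ∧ nm ω a = nm ω'' a) with hT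
    rcases T.eq_empty_or_nonempty with he | ⟨ω₀, hω₀⟩
    · rw [he]; simp
    · have hT' : ∀ ω ∈ T, (1 : ℝ) / nameCount nm (insert a B) ω = 1 / T.card := by
        intro ω hω
        congr 2
        unfold nameCount
        congr 1
        ext ω₁
        simp only [hT, Finset.mem_filter, Finset.mem_univ, true_and, Finset.mem_insert,
          forall_eq_or_imp] at hω ⊢
        constructor
        · rintro ⟨h1, h2⟩
          exact ⟨fun g hg => (h2 g hg).symm.trans (hω.1 g hg), h1.symm.trans hω.2⟩
        · rintro ⟨h1, h2⟩
          exact ⟨hω.2.trans h2.symm, fun g hg => (hω.1 g hg).trans (h1 g hg).symm⟩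
      rw [Finset.sum_congr rfl hT', Finset.sum_const, nsmul_eq_mul]
      have : (T.card : ℝ) ≠ 0 := by
        exact_mod_cast (Finset.card_pos.2 ⟨ω₀, hω₀⟩).ne'
      rw [mul_one_div, div_self this]
  have h2 : ∀ ω : Ω, (nameCount nm (insert a A) ω : ℝ) * nameCount nm B ω /
      (nameCount nm A ω * nameCount nm (insert a B) ω) =
      ∑ ω', ∑ ω'', (if ∀ g ∈ A, nm ω' g = nm ω'' g then 1 / (nameCount nm A ω' : ℝ) *
        (if (∀ g ∈ B, nm ω g = nm ω' g) ∧ nm ω a = nm ω'' a then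
          1 / (nameCount nm (insert a B) ω : ℝ) else 0) else 0) := by
    intro ω
    have e1 : ∀ ω' ω'', (if ∀ g ∈ A, nm ω' g = nm ω'' g then 1 / (nameCount nm A ω' : ℝ) *
        (if (∀ g ∈ B, nm ω g = nm ω' g) ∧ nm ω a = nm ω'' a then
          1 / (nameCount nm (insert a B) ω : ℝ) else 0) else 0) =
        (if (∀ g ∈ B, nm ω g = nm ω' g) then 1 else 0) *
        ((if (∀ g ∈ insert a A, nm ω g = nm ω'' g) then 1 else 0) *
          (1 / (nameCount nm A ω * nameCount nm (insert a B) ω : ℝ))) := by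
      intro ω' ω''
      by_cases hB : ∀ g ∈ B, nm ω g = nm ω' g
      · have hN := nameCount_congr nm A (fun g hg => hB g (hAB hg))
        have hiff : (∀ g ∈ insert a A, nm ω g = nm ω'' g) ↔
            (∀ g ∈ A, nm ω' g = nm ω'' g) ∧ nm ω a = nm ω'' a := by
          rw [Finset.forall_mem_insert]
          constructor
          · rintro ⟨h3, h4⟩
            exact ⟨fun g hg => (hB g (hAB hg)).symm.trans (h4 g hg), h3⟩
          · rintro ⟨h3, h4⟩
            exact ⟨h4, fun g hg => (hB g (hAB hg)).trans (h3 g hg)⟩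
        rw [if_pos hB, one_mul]
        by_cases h5 : ∀ g ∈ A, nm ω' g = nm ω'' g
        · by_cases h6 : nm ω a = nm ω'' a
          · rw [if_pos h5, if_pos ⟨hB, h6⟩, if_pos (hiff.2 ⟨h5, h6⟩), hN, one_mul,
              one_div_mul_one_div]
          · rw [if_pos h5, if_neg (fun h => h6 h.2), if_neg (fun h => h6 (hiff.1 h).2)]
            simp
        · rw [if_neg h5, if_neg (fun h => h5 (hiff.1 h).1)]
          simp
      · simp [hB]
    simp_rw [e1]
    rw [← Finset.sum_mul_sum, ← Finset.sum_mul]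
    rw [Finset.sum_boole, Finset.sum_boole]
    unfold nameCount
    ring
  calc _ = ∑ ω, ∑ ω', ∑ ω'', (if ∀ g ∈ A, nm ω' g = nm ω'' g then 1 / (nameCount nm A ω' : ℝ) *
        (if (∀ g ∈ B, nm ω g = nm ω' g) ∧ nm ω a = nm ω'' a then
          1 / (nameCount nm (insert a B) ω : ℝ) else 0) else 0) :=
        Finset.sum_congr rfl fun ω _ => h2 ω
    _ = ∑ ω', ∑ ω'', ∑ ω, (if ∀ g ∈ A, nm ω' g = nm ω'' g then 1 / (nameCount nm A ω' : ℝ) *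
        (if (∀ g ∈ B, nm ω g = nm ω' g) ∧ nm ω a = nm ω'' a then
          1 / (nameCount nm (insert a B) ω : ℝ) else 0) else 0) := by
        rw [Finset.sum_comm]
        exact Finset.sum_congr rfl fun ω' _ => Finset.sum_comm
    _ ≤ ∑ ω', ∑ ω'', (if ∀ g ∈ A, nm ω' g = nm ω'' g then 1 / (nameCount nm A ω' : ℝ) else 0) := by
        refine Finset.sum_le_sum fun ω' _ => Finset.sum_le_sum fun ω'' _ => ?_
        by_cases h5 : ∀ g ∈ A, nm ω' g = nm ω'' g
        · rw [Finset.sum_congr rfl (fun ω _ => if_pos h5), if_pos h5, ← Finset.mul_sum]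
          have := h1 ω' ω''
          have h6 : (0 : ℝ) ≤ 1 / nameCount nm A ω' := (one_div_pos.2 (hpos A ω')).le
          calc _ ≤ 1 / (nameCount nm A ω' : ℝ) * 1 := mul_le_mul_of_nonneg_left this h6
            _ = _ := mul_one _
        · simp [h5]
    _ = ∑ ω' : Ω, (1 : ℝ) := by
        refine Finset.sum_congr rfl fun ω' _ => ?_
        rw [← Finset.sum_filter, Finset.sum_const, nsmul_eq_mul, mul_one_div]
        exact div_self (hpos A ω').ne'
    _ = _ := by simp

/-- Unnormalised entropy of the names. -/
noncomputable def nameEnt (nm : Ω → G → κ) (E : Finset G) : ℝ :=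
  ∑ ω, (Real.log (Fintype.card Ω) - Real.log (nameCount nm E ω))

lemma nameEnt_submod (nm : Ω → G → κ) (A B : Finset G) (a : G) (hAB : A ⊆ B) :
    nameEnt nm (insert a B) - nameEnt nm B ≤ nameEnt nm (insert a A) - nameEnt nm A := by
  have hpos : ∀ E ω, (0 : ℝ) < nameCount nm E ω := fun E ω => by
    exact_mod_cast nameCount_pos nm E ω
  have h1 : (nameEnt nm (insert a B) - nameEnt nm B) - (nameEnt nm (insert a A) - nameEnt nm A) ≤
      ∑ ω, ((nameCount nm (insert a A) ω : ℝ) * nameCount nm B ω /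
      (nameCount nm A ω * nameCount nm (insert a B) ω) - 1) := by
    unfold nameEnt
    rw [← Finset.sum_sub_distrib, ← Finset.sum_sub_distrib, ← Finset.sum_sub_distrib]
    refine Finset.sum_le_sum fun ω _ => ?_
    have hA := hpos A ω
    have hB := hpos B ω
    have hA' := hpos (insert a A) ω
    have hB' := hpos (insert a B) ω
    refine le_trans (le_of_eq ?_) (Real.log_le_sub_one_of_pos (by positivity))
    rw [Real.log_div (by positivity) (by positivity), Real.log_mul hA'.ne' hB.ne',
      Real.log_mul hA.ne' hB'.ne']
    ring
  rw [Finset.sum_sub_distrib] at h1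
  have h2 := submod_sum nm A B a hAB
  simp only [Finset.sum_const, Finset.card_univ, nsmul_eq_mul, mul_one] at h1
  linarith

lemma nameEnt_mono (nm : Ω → G → κ) (A B : Finset G) (hAB : A ⊆ B) :
    nameEnt nm A ≤ nameEnt nm B := by
  unfold nameEnt
  refine Finset.sum_le_sum fun ω _ => ?_
  have h1 : (nameCount nm B ω : ℝ) ≤ nameCount nm A ω := by
    exact_mod_cast nameCount_anti nm hAB ω
  have h2 : (0 : ℝ) < nameCount nm B ω := by exact_mod_cast nameCount_pos nm B ω
  have := Real.log_le_log h2 h1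
  linarith

lemma nameEnt_empty (nm : Ω → G → κ) : nameEnt nm ∅ = 0 := by
  unfold nameEnt nameCount
  simp

lemma nameEnt_inj (nm : Ω → G → κ) (E : Finset G)
    (hinj : ∀ ω ω', (∀ g ∈ E, nm ω g = nm ω' g) → ω = ω') :
    nameEnt nm E = Fintype.card Ω * Real.log (Fintype.card Ω) := by
  unfold nameEnt
  have : ∀ ω, nameCount nm E ω = 1 := by
    intro ω
    unfold nameCount
    rw [Finset.card_eq_one]
    refine ⟨ω, ?_⟩
    ext ω'
    simp only [Finset.mem_filter, Finset.mem_univ, true_and, Finset.mem_singleton]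
    exact ⟨fun h => (hinj _ _ h).symm, fun h => by simp [h]⟩
  simp [this]

lemma nameEnt_eq {W : Type*} [Fintype W] [DecidableEq W] [Nonempty Ω] (nm : Ω → G → κ)
    (E : Finset G) (π : Ω → W)
    (hπ : ∀ ω ω', (∀ g ∈ E, nm ω g = nm ω' g) ↔ π ω = π ω') :
    nameEnt nm E = Fintype.card Ω * ∑ w, Real.negMulLog
      (((Finset.univ.filter (fun ω => π ω = w)).card : ℝ) / Fintype.card Ω) := by
  have hΩ : (0 : ℝ) < Fintype.card Ω := by exact_mod_cast Fintype.card_pos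
  unfold nameEnt
  rw [← Finset.sum_fiberwise Finset.univ π, Finset.mul_sum]
  refine Finset.sum_congr rfl fun w _ => ?_
  set T := Finset.univ.filter (fun ω => π ω = w) with hT
  have h1 : ∀ ω ∈ T, Real.log (Fintype.card Ω) - Real.log (nameCount nm E ω) =
      Real.log (Fintype.card Ω) - Real.log T.card := by
    intro ω hω
    have hω' : π ω = w := (Finset.mem_filter.1 hω).2
    congr 3
    unfold nameCount
    congr 1
    ext ω'
    simp only [hT, Finset.mem_filter, Finset.mem_univ, true_and, hπ, hω']
    exact eq_comm
  rw [Finset.sum_congr rfl h1, Finset.sum_const, nsmul_eq_mul]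
  rcases T.eq_empty_or_nonempty with he | hne
  · simp [he]
  · have hTc : (0 : ℝ) < T.card := by exact_mod_cast hne.card_pos
    unfold Real.negMulLog
    rw [Real.log_div hTc.ne' hΩ.ne']
    field_simp
    ring
end PartC1

set_option linter.unusedSectionVars false
set_option linter.unusedVariables false
open MeasureTheory Filter Set
open scoped Pointwise ENNReal NNReal Topology

section PartC2

lemma sum_negMulLog_le_log {Ω W : Type*} [Fintype Ω] [Nonempty Ω] [Fintype W] [DecidableEq W]
    (π : Ω → W) : ∑ w, Real.negMulLog
      (((Finset.univ.filter (fun ω => π ω = w)).card : ℝ) / Fintype.card Ω) ≤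
      Real.log (Fintype.card W) := by
  have hΩ : (0 : ℝ) < Fintype.card Ω := by exact_mod_cast Fintype.card_pos
  have h1 := sum_negMulLog_le (Finset.univ : Finset W)
    (fun w => ((Finset.univ.filter (fun ω => π ω = w)).card : ℝ) / Fintype.card Ω)
    (fun w => by positivity)
  have h2 : ∑ w, ((Finset.univ.filter (fun ω => π ω = w)).card : ℝ) / Fintype.card Ω = 1 := by
    rw [← Finset.sum_div, div_eq_one_iff_eq hΩ.ne']
    have := Finset.card_eq_sum_card_fiberwise (f := π) (s := Finset.univ) (t := Finset.univ)
      (fun _ _ => Finset.mem_coe.2 (Finset.mem_univ _))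
    rw [Finset.card_univ] at this
    rw [this]
    push_cast
    rfl
  rw [h2, Finset.card_univ] at h1
  linarith

variable {G : Type*} [Group G] [DecidableEq G] {X : Type*} [MulAction G X]

lemma ent_union_le (h : Finset G → ℝ) (M : ℝ) (hM : ∀ A a, h (insert a A) ≤ h A + M)
    (A B : Finset G) : h (B ∪ A) ≤ h A + B.card * M := by
  induction B using Finset.induction_on with
  | empty => simp
  | insert b B hb ih =>
    rw [Finset.insert_union, Finset.card_insert_of_notMem hb]
    push_cast
    have := hM (B ∪ A) b
    linarith

lemma card_deg (K E : Finset G) (g : G) (hg : ¬ ∃ k ∈ K⁻¹, k * g ∉ E) :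
    K.card ≤ (E.filter (fun c => g ∈ tile K c)).card := by
  refine Finset.card_le_card_of_injOn (fun k => k⁻¹ * g) ?_ ?_
  · intro k hk
    push Not at hg
    simp only [Finset.coe_filter]
    refine ⟨hg k⁻¹ (Finset.inv_mem_inv hk), ?_⟩
    rw [mem_tile]
    simpa using hk
  · intro a _ b _ hab
    simpa using hab

lemma count_arith (O Kc L bd lk E H γ hE hIntg : ℝ) {S : ℝ} (hO : 0 < O) (hK : 1 ≤ Kc) (hE0 : 0 < E)
    (hlk : 0 ≤ lk) (hγ : 0 < γ) (h1 : hE ≤ hIntg + bd * (O * lk)) (h2 : Kc * hIntg ≤ S)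
    (h6 : S ≤ O * (E * (H + γ / 2))) (h7 : hE = O * L) (hn : bd ≤ γ / 2 / (lk + 1) * E) :
    L ≤ E * (H / Kc + γ) := by
  have hK0 : 0 < Kc := by linarith
  have h8 : Kc * L ≤ Kc * (bd * lk) + E * (H + γ / 2) := by
    have h9 : O * (Kc * L) ≤ O * (Kc * (bd * lk) + E * (H + γ / 2)) := by
      have := mul_le_mul_of_nonneg_left h1 hK0.le
      rw [h7] at this
      linarith
    exact le_of_mul_le_mul_left h9 hO
  have h10 : bd * lk ≤ γ / 2 * E := by
    have : bd * lk ≤ γ / 2 / (lk + 1) * E * lk := mul_le_mul_of_nonneg_right hn hlk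
    refine this.trans ?_
    have e : γ / 2 / (lk + 1) * E * lk = (lk / (lk + 1)) * (γ / 2 * E) := by ring
    rw [e]
    have : lk / (lk + 1) ≤ 1 := by
      rw [div_le_one (by positivity)]; linarith
    have h0 : 0 ≤ γ / 2 * E := by positivity
    nlinarith
  have h11 : Kc * L ≤ Kc * (E * (H / Kc + γ)) := by
    have e : Kc * (E * (H / Kc + γ)) = E * H + Kc * (E * γ) := by
      field_simp
    rw [e]
    have h12 := mul_le_mul_of_nonneg_left h10 hK0.le
    have h13 : (0 : ℝ) ≤ E * γ := by positivity
    nlinarith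
  exact le_of_mul_le_mul_left h11 hK0

lemma count_names (F : ℕ → Finset G) (hFol : IsFolnerSeq F) {k : ℕ} (α : X → Fin k)
    (K : Finset G) (hK : K.Nonempty) (p : (↥K → Fin k) → ℝ) (γ : ℝ) (hγ : 0 < γ) :
    ∃ δ > 0, ∀ᶠ n in atTop, ∀ Ω : Finset X, Ω.Nonempty →
      (∀ ω ∈ Ω, ∀ w : ↥K → Fin k,
        |(((F n).filter (fun c => ∀ g : ↥K, α ((g : G) • c • ω) = w g)).card : ℝ) / (F n).card
          - p w| < δ) →
      (∀ ω ∈ Ω, ∀ ω' ∈ Ω, (∀ g ∈ F n, α (g • ω) = α (g • ω')) → ω = ω') →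
      Real.log Ω.card ≤ (F n).card * ((∑ w, Real.negMulLog (p w)) / K.card + γ) := by
  classical
  have hKc : (1 : ℝ) ≤ K.card := by exact_mod_cast hK.card_pos
  have hKc0 : (0 : ℝ) < K.card := by linarith
  set γ₁ := γ / 2 / (Fintype.card (↥K → Fin k) + 1) with hγ₁
  have hγ₁0 : 0 < γ₁ := by positivity
  have hlk : 0 ≤ Real.log k := Real.log_natCast_nonneg k
  obtain ⟨δ, hδ, hδ'⟩ : ∃ δ > 0, ∀ w : (↥K → Fin k), ∀ t : ℝ, |t - p w| < δ →
      Real.negMulLog t ≤ Real.negMulLog (p w) + γ₁ := by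
    have h1 : ∀ w : (↥K → Fin k), ∃ δ > 0, ∀ t : ℝ, |t - p w| < δ →
        Real.negMulLog t ≤ Real.negMulLog (p w) + γ₁ := by
      intro w
      obtain ⟨δ, hδ, h⟩ := Metric.continuousAt_iff.1
        (Real.continuous_negMulLog.continuousAt (x := p w)) γ₁ hγ₁0
      refine ⟨δ, hδ, fun t ht => ?_⟩
      have := h (x := t) (by rwa [Real.dist_eq])
      rw [Real.dist_eq] at this
      linarith [le_abs_self (Real.negMulLog t - Real.negMulLog (p w))]
    choose d hd0 hd using h1
    rcases isEmpty_or_nonempty (↥K → Fin k) with hemp | hne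
    · exact ⟨1, one_pos, fun w => (hemp.false w).elim⟩
    · refine ⟨Finset.univ.inf' Finset.univ_nonempty d, ?_, ?_⟩
      · exact (Finset.lt_inf'_iff _).2 fun w _ => hd0 w
      · intro w t ht
        exact hd w t (ht.trans_le (Finset.inf'_le _ (Finset.mem_univ w)))
  refine ⟨δ, hδ, ?_⟩
  have hη : 0 < γ / 2 / (Real.log k + 1) := by positivity
  filter_upwards [folner_bdry hFol K⁻¹ hη] with n hn
  intro Ω hΩ hfreq hinj
  set E := F n with hE
  have hEc : (0 : ℝ) < E.card := by exact_mod_cast (hFol.1 n).card_pos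
  have : Nonempty ↥Ω := hΩ.to_subtype
  have hΩc : (0 : ℝ) < Fintype.card ↥Ω := by exact_mod_cast Fintype.card_pos
  set nm : ↥Ω → G → Fin k := fun ω g => α (g • (ω : X)) with hnm
  set h : Finset G → ℝ := nameEnt nm with hh
  set M := Fintype.card ↥Ω * Real.log k with hM
  have hins : ∀ A a, h (insert a A) ≤ h A + M := by
    intro A a
    have h1 := nameEnt_submod nm ∅ A a (Finset.empty_subset _)
    rw [nameEnt_empty, sub_zero, insert_empty_eq] at h1
    have h2 : nameEnt nm {a} ≤ M := by
      rw [nameEnt_eq nm {a} (fun ω => nm ω a) (fun ω ω' => by simp), hM]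
      refine mul_le_mul_of_nonneg_left ?_ hΩc.le
      refine (sum_negMulLog_le_log _).trans (le_of_eq ?_)
      simp
    change nameEnt nm (insert a A) ≤ nameEnt nm A + M
    linarith
  set bd := E.filter (fun a => ∃ k ∈ K⁻¹, k * a ∉ E) with hbd
  set int := E.filter (fun a => ¬ ∃ k ∈ K⁻¹, k * a ∉ E) with hIntg
  have hEu : bd ∪ int = E := Finset.filter_union_filter_not_eq _ _
  have h1 : h E ≤ h int + bd.card * M := by
    have := ent_union_le h M hins int bd
    rwa [hEu] at this
  have h2 : (K.card : ℝ) * h int ≤ ∑ c ∈ E, h (tile K c) := by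
    refine (shearer_abstract h (fun A B a hAB => nameEnt_submod nm A B a hAB)
      (fun A B hAB => nameEnt_mono nm A B hAB) (nameEnt_empty nm) E (fun c => tile K c) K.card int
      fun g hg => card_deg K E g (Finset.mem_filter.1 hg).2).trans ?_
    exact Finset.sum_le_sum fun c _ => nameEnt_mono nm _ _ Finset.inter_subset_left
  -- names on tiles
  set π : G → ↥Ω → (↥K → Fin k) := fun c ω g => α ((g : G) • c • (ω : X)) with hπ
  set P : G → (↥K → Fin k) → ℝ := fun c w =>
    ((Finset.univ.filter (fun ω => π c ω = w)).card : ℝ) / Fintype.card ↥Ω with hP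
  have h3 : ∀ c, h (tile K c) = Fintype.card ↥Ω * ∑ w, Real.negMulLog (P c w) := by
    intro c
    refine nameEnt_eq nm (tile K c) (π c) fun ω ω' => ?_
    constructor
    · intro hh
      funext g
      have := hh (g * c) (by rw [mem_tile]; simp)
      simpa [hnm, hπ, mul_smul] using this
    · intro hh g hg
      have := congrFun hh ⟨g * c⁻¹, mem_tile.1 hg⟩
      simp only [hπ, smul_smul] at this
      simpa using this
  have h4 : ∀ w, ∑ c ∈ E, Real.negMulLog (P c w) ≤ E.card * (Real.negMulLog (p w) + γ₁) := by
    intro w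
    have hJ := Real.concaveOn_negMulLog.le_map_sum (t := E) (w := fun _ => 1 / (E.card : ℝ))
      (p := fun c => P c w) (fun _ _ => by positivity)
      (by rw [Finset.sum_const, nsmul_eq_mul]; field_simp)
      (fun c _ => by
        change (0 : ℝ) ≤ _
        positivity)
    simp only [smul_eq_mul, ← Finset.mul_sum] at hJ
    have havg : |1 / (E.card : ℝ) * ∑ c ∈ E, P c w - p w| < δ := by
      have e1 : ∑ c ∈ E, P c w = (∑ ω : ↥Ω,
          ((E.filter (fun c => ∀ g : ↥K, α ((g : G) • c • (ω : X)) = w g)).card : ℝ)) /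
            Fintype.card ↥Ω := by
        simp only [hP]
        rw [← Finset.sum_div]
        congr 1
        simp only [Finset.card_filter, Nat.cast_sum]
        rw [Finset.sum_comm]
        refine Finset.sum_congr rfl fun ω _ => Finset.sum_congr rfl fun c _ => ?_
        have : π c ω = w ↔ ∀ g : ↥K, α ((g : G) • c • (ω : X)) = w g := by
          rw [funext_iff]
        simp only [this]
      have e2 : 1 / (E.card : ℝ) * ∑ c ∈ E, P c w - p w = (∑ ω : ↥Ω,
          (((E.filter (fun c => ∀ g : ↥K, α ((g : G) • c • (ω : X)) = w g)).card : ℝ) / E.card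
            - p w)) / Fintype.card ↥Ω := by
        rw [e1, Finset.sum_sub_distrib, ← Finset.sum_div, Finset.sum_const, Finset.card_univ,
          nsmul_eq_mul]
        field_simp
      rw [e2, abs_div, abs_of_pos hΩc, div_lt_iff₀ hΩc]
      refine (Finset.abs_sum_le_sum_abs _ _).trans_lt ?_
      refine (Finset.sum_lt_sum_of_nonempty (s := (Finset.univ : Finset ↥Ω)) Finset.univ_nonempty
        fun ω _ => hfreq ω ω.2 w).trans_le (le_of_eq ?_)
      rw [Finset.sum_const, Finset.card_univ, nsmul_eq_mul, mul_comm]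
    have h5 := hJ.trans (hδ' w _ havg)
    rw [one_div, inv_mul_le_iff₀ hEc] at h5
    exact h5
  have h6 : ∑ c ∈ E, h (tile K c) ≤
      Fintype.card ↥Ω * (E.card * (∑ w, Real.negMulLog (p w) + γ / 2)) := by
    simp_rw [h3]
    rw [← Finset.mul_sum, Finset.sum_comm]
    refine mul_le_mul_of_nonneg_left ?_ hΩc.le
    refine (Finset.sum_le_sum fun w _ => h4 w).trans ?_
    rw [← Finset.mul_sum, Finset.sum_add_distrib, Finset.sum_const, Finset.card_univ, nsmul_eq_mul]
    refine mul_le_mul_of_nonneg_left ?_ hEc.le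
    have : (Fintype.card (↥K → Fin k) : ℝ) * γ₁ ≤ γ / 2 := by
      rw [hγ₁, mul_div_assoc', div_le_iff₀ (by positivity)]
      nlinarith
    linarith
  have h7 : h E = Fintype.card ↥Ω * Real.log (Fintype.card ↥Ω) :=
    nameEnt_inj nm E fun ω ω' hh => Subtype.ext (hinj ω ω.2 ω' ω'.2 hh)
  have hcc : Fintype.card ↥Ω = Ω.card := Fintype.card_coe Ω
  rw [← hcc]
  exact count_arith _ _ _ _ _ _ _ _ _ _ hΩc hKc hEc hlk hγ h1 h2 h6 h7 hn
end PartC2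

set_option linter.unusedSectionVars false
set_option linter.unusedVariables false
open MeasureTheory Filter Set
open scoped Pointwise ENNReal NNReal Topology

section PartC3
variable {G : Type*} [Group G] [DecidableEq G] {X : Type*} [MetricSpace X] [CompactSpace X]
  [MulAction G X] [ContinuousConstSMul G X] [MeasurableSpace X] [BorelSpace X]

lemma exists_partition (μ : Measure X) [IsProbabilityMeasure μ] {ε : ℝ} (hε : 0 < ε) :
    ∃ (k : ℕ) (α : X → Fin k), Measurable α ∧ (∀ x y, α x = α y → dist x y < ε) ∧
      ∃ B : Set X, IsClosed B ∧ μ B = 0 ∧ ∀ x, x ∉ B → ∀ᶠ y in 𝓝 x, α y = α x := by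
  classical
  have hr : ∀ x : X, ∃ r ∈ Ioo (0:ℝ) (ε/2), μ (frontier (Metric.ball x r)) = 0 := by
    intro x
    obtain ⟨r, hr, h⟩ := exists_null_frontier_thickening μ {x} (half_pos hε)
    rw [Metric.thickening_singleton] at h
    exact ⟨r, hr, h⟩
  choose r hr hnull using hr
  obtain ⟨t, -, ht⟩ := isCompact_univ.elim_nhds_subcover (fun x => Metric.ball x (r x))
    (fun x _ => Metric.ball_mem_nhds x (hr x).1)
  have hcov : ∀ y : X, ∃ x : ↥t, y ∈ Metric.ball (x : X) (r x) := by
    intro y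
    have := ht (mem_univ y)
    simp only [mem_iUnion] at this
    obtain ⟨x, hx, h⟩ := this
    exact ⟨⟨x, hx⟩, h⟩
  obtain ⟨x0⟩ : Nonempty X := by
    by_contra hne
    rw [not_nonempty_iff] at hne
    have := measure_univ (μ := μ)
    rw [univ_eq_empty_iff.2 hne] at this
    simp at this
  obtain ⟨t0, -⟩ := hcov x0
  let pick : (↥t → Prop) → ↥t := fun P => if h : ∃ i, P i then h.choose else t0
  have hpick : ∀ P : ↥t → Prop, (∃ i, P i) → P (pick P) := by
    intro P h
    simp only [pick, dif_pos h]
    exact h.choose_spec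
  let S : X → (↥t → Prop) := fun y x => y ∈ Metric.ball (x : X) (r x)
  have hS : Measurable S := by
    refine measurable_pi_iff.2 fun x => ?_
    exact measurableSet_setOfPred.1 (Metric.isOpen_ball (x := (x:X)) (ε := r x)).measurableSet
  refine ⟨t.card, fun y => t.equivFin (pick (S y)), ?_, ?_, ?_⟩
  · exact (measurable_of_countable (fun P : ↥t → Prop => t.equivFin (pick P))).comp hS
  · intro x y hxy
    have h := t.equivFin.injective hxy
    have hx := hpick (S x) (hcov x)
    have hy := hpick (S y) (hcov y)
    rw [← h] at hy
    have h1 : dist x (pick (S x) : X) < r (pick (S x)) := hx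
    have h2 : dist y (pick (S x) : X) < r (pick (S x)) := hy
    have := (hr (pick (S x) : X)).2
    have := dist_triangle_right x y (pick (S x) : X)
    linarith
  · refine ⟨⋃ x : ↥t, frontier (Metric.ball (x:X) (r x)), ?_, ?_, ?_⟩
    · exact isClosed_iUnion_of_finite fun x => isClosed_frontier
    · exact measure_iUnion_null fun x => hnull x
    · intro y hy
      simp only [mem_iUnion, not_exists] at hy
      have : ∀ᶠ z in 𝓝 y, ∀ x : ↥t, (S z x ↔ S y x) := by
        rw [eventually_all]
        intro x
        by_cases hyx : S y x
        · have : Metric.ball (x:X) (r x) ∈ 𝓝 y := Metric.isOpen_ball.mem_nhds hyx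
          filter_upwards [this] with z hz
          exact ⟨fun _ => hyx, fun _ => hz⟩
        · have hc : y ∉ closure (Metric.ball (x:X) (r x)) := by
            intro hc
            exact hy x ⟨hc, by rwa [Metric.isOpen_ball.interior_eq]⟩
          have : (closure (Metric.ball (x:X) (r x)))ᶜ ∈ 𝓝 y :=
            isClosed_closure.isOpen_compl.mem_nhds hc
          filter_upwards [this] with z hz
          exact ⟨fun h => absurd (subset_closure h) hz, fun h => absurd h hyx⟩
      filter_upwards [this] with z hz
      have : S z = S y := funext fun x => propext (hz x)
      simp only [this]

lemma freq_tendsto (F : ℕ → Finset G) (hne : ∀ n, (F n).Nonempty) (μ : Measure X)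
    [IsProbabilityMeasure μ] {x : X} (hx : x ∈ genericPointSet F μ) (A : Set X)
    (hA : MeasurableSet A) (hfr : μ (frontier A) = 0) [DecidablePred (fun c : G => c • x ∈ A)] :
    Tendsto (fun n => (((F n).filter (fun c => c • x ∈ A)).card : ℝ) / (F n).card) atTop
      (𝓝 (μ A).toReal) := by
  let ν : ℕ → Measure X := fun n => ((F n).card : ℝ≥0∞)⁻¹ • ∑ g ∈ F n, Measure.dirac (g • x)
  have hc0 : ∀ n, ((F n).card : ℝ≥0∞) ≠ 0 := fun n => by
    exact_mod_cast (Finset.card_pos.2 (hne n)).ne'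
  have hc1 : ∀ n, ((F n).card : ℝ≥0∞) ≠ ⊤ := fun n => ENNReal.natCast_ne_top _
  have hν : ∀ n, IsProbabilityMeasure (ν n) := by
    intro n
    constructor
    simp only [ν, Measure.smul_apply, Measure.finsetSum_apply, measure_univ, Finset.sum_const,
      smul_eq_mul, nsmul_eq_mul, mul_one]
    exact ENNReal.inv_mul_cancel (hc0 n) (hc1 n)
  let N : ℕ → ProbabilityMeasure X := fun n => ⟨ν n, hν n⟩
  let M : ProbabilityMeasure X := ⟨μ, inferInstance⟩
  have hlim : Tendsto N atTop (𝓝 M) := by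
    rw [ProbabilityMeasure.tendsto_iff_forall_integral_tendsto]
    intro f
    have h := hx f.toContinuousMap
    refine h.congr fun n => ?_
    change _ = ∫ y, f y ∂(ν n)
    simp only [ν]
    rw [integral_smul_measure, integral_finsetSum_measure]
    · simp only [integral_dirac]
      simp [div_eq_inv_mul]
    · intro g _
      exact f.integrable _
  have h2 := ProbabilityMeasure.tendsto_measure_of_null_frontier_of_tendsto' hlim (E := A) hfr
  have h3 := (ENNReal.tendsto_toReal (measure_ne_top μ A)).comp h2
  refine h3.congr fun n => ?_
  change (ν n A).toReal = _
  simp only [ν, Measure.smul_apply, Measure.finsetSum_apply, Measure.dirac_apply' _ hA,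
    smul_eq_mul]
  have : ∑ g ∈ F n, A.indicator (1 : X → ℝ≥0∞) (g • x) =
      (((F n).filter (fun c => c • x ∈ A)).card : ℝ≥0∞) := by
    rw [Finset.card_filter]
    push_cast
    exact Finset.sum_congr rfl fun g _ => by simp [indicator_apply]
  rw [this, ENNReal.toReal_mul, ENNReal.toReal_inv]
  simp [div_eq_inv_mul]

lemma frontier_name_null (μ : Measure X) (hinv : InvariantMeasure G μ) {k : ℕ} (α : X → Fin k)
    {B : Set X} (hBc : IsClosed B) (hB : μ B = 0) (hloc : ∀ x, x ∉ B → ∀ᶠ y in 𝓝 x, α y = α x)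
    (K : Finset G) (w : ↥K → Fin k) :
    μ (frontier {y | ∀ g : ↥K, α ((g : G) • y) = w g}) = 0 := by
  refine measure_mono_null (t := ⋃ g : ↥K, (fun y => (g : G) • y) ⁻¹' B) ?_ ?_
  · intro y hy
    by_contra hn
    simp only [mem_iUnion, mem_preimage, not_exists] at hn
    have hev : ∀ᶠ z in 𝓝 y, ∀ g : ↥K, α ((g:G) • z) = α ((g:G) • y) := by
      rw [eventually_all]
      intro g
      exact (continuous_const_smul (g:G)).continuousAt.eventually (hloc _ (hn g))
    by_cases hyA : ∀ g : ↥K, α ((g : G) • y) = w g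
    · apply hy.2
      rw [mem_interior_iff_mem_nhds]
      filter_upwards [hev] with z hz g
      rw [hz, hyA]
    · have := mem_closure_iff_frequently.1 hy.1
      obtain ⟨z, hz1, hz2⟩ := (this.and_eventually hev).exists
      exact hyA fun g => by rw [← hz2 g]; exact hz1 g
  · refine measure_iUnion_null fun g => ?_
    rw [(mp_smul hinv (g:G)).measure_preimage hBc.measurableSet.nullMeasurableSet, hB]

end PartC3

set_option linter.unusedSectionVars false
set_option linter.unusedVariables false
open MeasureTheory Filter Set
open scoped Pointwise ENNReal NNReal Topology

section PartC4
variable {G : Type*} [Group G] [DecidableEq G] {X : Type*} [MetricSpace X] [CompactSpace X]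
  [MulAction G X] [ContinuousConstSMul G X] [MeasurableSpace X] [BorelSpace X]

lemma exists_reps {k : ℕ} (α : X → Fin k) (E : Finset G) (Z : Set X) :
    ∃ Ω : Finset X, (∀ ω ∈ Ω, ω ∈ Z) ∧
      (∀ ω ∈ Ω, ∀ ω' ∈ Ω, (∀ g ∈ E, α (g • ω) = α (g • ω')) → ω = ω') ∧
      ∀ y ∈ Z, ∃ ω ∈ Ω, ∀ g ∈ E, α (g • ω) = α (g • y) := by
  classical
  let φ : X → (↥E → Fin k) := fun x g => α ((g : G) • x)
  obtain ⟨s, hs, hbij⟩ := (surjOn_image φ Z).exists_bijOn_subset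
  have hfin : s.Finite := Set.Finite.of_finite_image
    (by rw [hbij.image_eq]; exact Set.toFinite _) hbij.injOn
  refine ⟨hfin.toFinset, fun ω hω => hs (hfin.mem_toFinset.1 hω), ?_, ?_⟩
  · intro ω hω ω' hω' h
    exact hbij.injOn (hfin.mem_toFinset.1 hω) (hfin.mem_toFinset.1 hω')
      (funext fun g => h g g.2)
  · intro y hy
    obtain ⟨ω, hω, h⟩ := hbij.surjOn (mem_image_of_mem φ hy)
    exact ⟨ω, hfin.mem_toFinset.2 hω, fun g hg => congrFun h ⟨g, hg⟩⟩

lemma bowenMpre_generic_eq_zero (F : ℕ → Finset G) (hFol : IsFolnerSeq F) (hGrow : GrowthCond F)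
    (μ : Measure X) [IsProbabilityMeasure μ] (hinv : InvariantMeasure G μ) {s : ℝ}
    (hs : measEntropy F μ < ENNReal.ofReal s) {ε : ℝ} (hε : 0 < ε) (N₀ : ℕ) :
    bowenMpre F (genericPointSet F μ) N₀ ε s = 0 := by
  classical
  obtain ⟨s1, hs10, hs1, hs2⟩ := ENNReal.lt_iff_exists_real_btwn.1 hs
  have hs1s : s1 < s := by
    by_contra hcon
    exact absurd hs2 (not_lt.2 (ENNReal.ofReal_le_ofReal (not_lt.1 hcon)))
  obtain ⟨k, α, hα, hdist, B, hBc, hB, hloc⟩ := exists_partition μ hε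
  have hlim : limsup (fun n => ENNReal.ofReal (partitionEntropy μ α (F n) / (F n).card)) atTop
      < ENNReal.ofReal s1 :=
    lt_of_le_of_lt (by
      unfold measEntropy
      refine le_iSup_of_le k ?_
      refine le_iSup_of_le (f := fun β : X → Fin k => ⨆ (_ : Measurable β),
        limsup (fun n => ENNReal.ofReal (partitionEntropy μ β (F n) / (F n).card)) atTop) α ?_
      exact le_iSup_of_le hα le_rfl) hs1
  obtain ⟨m, hm⟩ := (eventually_lt_of_limsup_lt hlim).exists
  have hm' : partitionEntropy μ α (F m) / (F m).card < s1 := by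
    by_contra hcon
    exact absurd hm (not_lt.2 (ENNReal.ofReal_le_ofReal (not_lt.1 hcon)))
  set γ := (s - s1) / 2 with hγdef
  have hγ : 0 < γ := by rw [hγdef]; linarith
  set p : (↥(F m) → Fin k) → ℝ :=
    fun w => (μ {x | ∀ g : ↥(F m), α ((g : G) • x) = w g}).toReal with hp
  obtain ⟨δ, hδ, hcount⟩ := count_names F hFol α (F m) (hFol.1 m) p γ hγ
  let good : ℕ → X → Prop := fun n ω => ∀ w : ↥(F m) → Fin k,
    |(((F n).filter (fun c => ∀ g : ↥(F m), α ((g : G) • c • ω) = w g)).card : ℝ) / (F n).card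
      - p w| < δ
  have hgen : ∀ x ∈ genericPointSet F μ, ∀ᶠ n in atTop, good n x := by
    intro x hx
    simp only [good]
    rw [eventually_all]
    intro w
    have hA : MeasurableSet {y : X | ∀ g : ↥(F m), α ((g : G) • y) = w g} := by
      rw [ofPred_forall]
      exact MeasurableSet.iInter fun g =>
        (hα.comp (measurable_smulX (g : G))) (measurableSet_singleton (w g))
    have h := freq_tendsto F hFol.1 μ hx _ hA (frontier_name_null μ hinv α hBc hB hloc (F m) w)
    have h2 := (Metric.tendsto_nhds.1 h) δ hδ
    filter_upwards [h2] with n hn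
    rw [Real.dist_eq] at hn
    exact hn
  have hdecay : Tendsto (fun n => ENNReal.ofReal (Real.exp (-γ * ((F n).card : ℝ)))) atTop
      (𝓝 0) := by
    have h1 : Tendsto (fun n => -γ * ((F n).card : ℝ)) atTop atBot :=
      (card_tendsto hGrow).const_mul_atTop_of_neg (by linarith)
    have h2 := ENNReal.tendsto_ofReal (Real.tendsto_exp_atBot.comp h1)
    simpa using h2
  refine le_antisymm (ENNReal.le_of_forall_pos_le_add ?_) zero_le
  intro τ hτ _
  obtain ⟨τ', hτ', hsum⟩ := ENNReal.exists_pos_sum_of_countable'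
    (ε := (τ : ℝ≥0∞)) (by exact_mod_cast hτ.ne') ℕ
  have hstep : ∀ N : ℕ, ∃ (n : ℕ) (Ω : Finset X), N₀ ≤ n ∧
      (∀ y, (∀ j ≥ N, good j y) → ∃ ω ∈ Ω, ∀ g ∈ F n, α (g • ω) = α (g • y)) ∧
      (Ω.card : ℝ≥0∞) * ENNReal.ofReal (Real.exp (-s * ((F n).card : ℝ))) ≤ τ' N := by
    intro N
    obtain ⟨n, ⟨⟨h1, h2⟩, h3⟩, h4⟩ := (((hcount.and (eventually_ge_atTop N)).and
      (eventually_ge_atTop N₀)).and (hdecay.eventually (gt_mem_nhds (hτ' N)))).exists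
    obtain ⟨Ω, hΩ1, hΩ2, hΩ3⟩ := exists_reps α (F n) {y | ∀ j ≥ N, good j y}
    refine ⟨n, Ω, h3, fun y hy => hΩ3 y hy, ?_⟩
    rcases Ω.eq_empty_or_nonempty with he | hne
    · simp [he]
    · have h5 := h1 Ω hne (fun ω hω => hΩ1 ω hω n h2) hΩ2
      have h6 : (∑ w, Real.negMulLog (p w)) / ((F m).card : ℝ) < s1 := hm'
      have hcpos : (0 : ℝ) < (F n).card := by exact_mod_cast Finset.card_pos.2 (hFol.1 n)
      have h7 : Real.log Ω.card ≤ (F n).card * (s1 + γ) :=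
        h5.trans (mul_le_mul_of_nonneg_left (by linarith) hcpos.le)
      have hΩpos : (0 : ℝ) < Ω.card := by exact_mod_cast Finset.card_pos.2 hne
      have h8 : (Ω.card : ℝ) ≤ Real.exp ((F n).card * (s1 + γ)) :=
        (Real.log_le_iff_le_exp hΩpos).1 h7
      refine le_trans ?_ h4.le
      rw [← ENNReal.ofReal_natCast, ← ENNReal.ofReal_mul hΩpos.le]
      apply ENNReal.ofReal_le_ofReal
      calc (Ω.card : ℝ) * Real.exp (-s * (F n).card)
          ≤ Real.exp ((F n).card * (s1 + γ)) * Real.exp (-s * (F n).card) :=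
            mul_le_mul_of_nonneg_right h8 (Real.exp_pos _).le
        _ = Real.exp (-γ * (F n).card) := by
            rw [← Real.exp_add]
            congr 1
            rw [hγdef]
            ring
  choose n Ω hn hcov hcost using hstep
  let C : ℕ → Finset (X × ℕ) := fun N => (Ω N).image (fun ω => (ω, n N))
  have hmain : bowenMpre F (genericPointSet F μ) N₀ ε s ≤
      ∑' q : (⋃ N, (C N : Set (X × ℕ))),
        ENNReal.ofReal (Real.exp (-s * ((F (q : X × ℕ).2).card : ℝ))) := by
    refine iInf₂_le (⋃ N, (C N : Set (X × ℕ))) ⟨?_, ?_, ?_⟩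
    · exact countable_iUnion fun N => (C N).countable_toSet
    · intro q hq
      simp only [C, mem_iUnion, Finset.mem_coe, Finset.mem_image] at hq
      obtain ⟨N, ω, -, rfl⟩ := hq
      exact hn N
    · intro y hy
      obtain ⟨N, hN⟩ := eventually_atTop.1 (hgen y hy)
      obtain ⟨ω, hω, h⟩ := hcov N y hN
      refine mem_iUnion₂.2 ⟨(ω, n N), ?_, ?_⟩
      · exact mem_iUnion.2 ⟨N, Finset.mem_coe.2 (Finset.mem_image_of_mem _ hω)⟩
      · intro g hg
        exact hdist _ _ (h g hg)
  rw [zero_add]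
  refine hmain.trans ((ENNReal.tsum_iUnion_le_tsum
    (fun q : X × ℕ => ENNReal.ofReal (Real.exp (-s * ((F q.2).card : ℝ))))
    (fun N => (C N : Set (X × ℕ)))).trans (le_trans (ENNReal.tsum_le_tsum fun N => ?_) hsum.le))
  refine le_trans ?_ (hcost N)
  rw [Finset.tsum_subtype' (C N)
    (fun q : X × ℕ => ENNReal.ofReal (Real.exp (-s * ((F q.2).card : ℝ))))]
  rw [Finset.sum_image (fun a _ b _ h => congrArg Prod.fst h)]
  simp

lemma bowenEntropy_generic_le (F : ℕ → Finset G) (hFol : IsFolnerSeq F) (hGrow : GrowthCond F)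
    (μ : Measure X) [IsProbabilityMeasure μ] (hinv : InvariantMeasure G μ) :
    bowenEntropy F (genericPointSet F μ) ≤ measEntropy F μ := by
  refine iSup₂_le fun s hs => ?_
  by_contra hcon
  have hlt := not_le.1 hcon
  have : bowenMeasure F (genericPointSet F μ) s = 0 := by
    refine le_antisymm (iSup₂_le fun ε hε => iSup_le fun N => ?_) zero_le
    exact (bowenMpre_generic_eq_zero F hFol hGrow μ hinv hlt hε N).le
  rw [this] at hs
  exact ENNReal.zero_ne_top hs

end PartC4

variable {G : Type*} [Group G] [Countable G] [Infinite G] [DecidableEq G]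
  {X : Type*} [MetricSpace X] [CompactSpace X] [MulAction G X] [ContinuousConstSMul G X]
  [MeasurableSpace X] [BorelSpace X]

theorem bowenEntropy_genericPoints_eq_measEntropy
    (F : ℕ → Finset G) (hFol : IsFolnerSeq F) (hTemp : IsTemperedSeq F) (hGrow : GrowthCond F)
    (μ : Measure X) [IsProbabilityMeasure μ] (hinv : InvariantMeasure G μ)
    (herg : ErgodicMeasure G μ) :
    bowenEntropy F (genericPointSet F μ) = measEntropy F μ := by
  exact le_antisymm (bowenEntropy_generic_le F hFol hGrow μ hinv)
    (measEntropy_le_bowenEntropy F hFol hTemp hGrow μ hinv _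
      (generic_full F hFol hTemp μ hinv herg))
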